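/- arXiv:1807.07198 — 2 statements merged into one kernel-verified Lean document; each statement's English description precedes it below -/
import Mathlib

section
/- Let A_S be an Artin-Tits group of spherical type (i.e., its Coxeter group W_S is finite) and let X be a nonempty proper subset of S. If (A_X, A_S) satisfies Property ⋆_A, then the standard parabolic subgroup A_X is conjugacy stable in A_S. -/
namespace ArtinTits

variable {B : Type*}

/-- The alternating product `a b a b ⋯` with `m` factors, starting with `a`. -/
def altProd {G : Type*} [Monoid G] (a b : G) : ℕ → G
  | 0 => 1
  | n + 1 => a * altProd b a n

/-- The braid relations defining the Artin–Tits group of a Coxeter matrix: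
`Π(σ_s, σ_t; m_{s,t}) = Π(σ_t, σ_s; m_{s,t})` whenever `m_{s,t} ≠ ∞` (here `∞` is coded by `0`). -/
def artinRelationsSet (M : CoxeterMatrix B) : Set (FreeGroup B) :=
  {r | ∃ s t : B, M s t ≠ 0 ∧
    r = altProd (FreeGroup.of s) (FreeGroup.of t) (M s t) *
        (altProd (FreeGroup.of t) (FreeGroup.of s) (M s t))⁻¹}

/-- The Artin–Tits group of a Coxeter matrix. -/
abbrev ArtinGroup (M : CoxeterMatrix B) : Type _ := PresentedGroup (artinRelationsSet M)

/-- The standard generator `σ_s` of the Artin–Tits group. -/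
def σ (M : CoxeterMatrix B) (s : B) : ArtinGroup M := PresentedGroup.of s

/-- The standard parabolic subgroup `A_X` of the Artin–Tits group. -/
def AP (M : CoxeterMatrix B) (X : Set B) : Subgroup (ArtinGroup M) :=
  Subgroup.closure (σ M '' X)

/-- The standard parabolic subgroup `W_X` of the Coxeter group. -/
def WP (M : CoxeterMatrix B) (X : Set B) : Subgroup M.Group :=
  Subgroup.closure (M.simple '' X)

/-- A subgroup `H ≤ G` is conjugacy stable if any two elements of `H` which are conjugate
in `G` are already conjugate by an element of `H`. -/
def IsConjugacyStable {G : Type*} [Group G] (H : Subgroup G) : Prop :=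
  ∀ a b : G, a ∈ H → b ∈ H → (∃ g : G, g⁻¹ * a * g = b) → ∃ h ∈ H, h⁻¹ * a * h = b

/-- Property `⋆_W` for the pair `(W_X, W_S)`. -/
def StarW (M : CoxeterMatrix B) (X : Set B) : Prop :=
  ∀ Y₁ Y₂ : Set B, Y₁ ⊆ X → Y₂ ⊆ X → ∀ w : M.Group,
    (fun x => w⁻¹ * x * w) '' (M.simple '' Y₁) = M.simple '' Y₂ →
    ∃ v ∈ WP M X, ∀ y ∈ Y₁, v⁻¹ * M.simple y * v = w⁻¹ * M.simple y * w

/-- Property `⋆_A` for the pair `(A_X, A_S)`. -/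
def StarA (M : CoxeterMatrix B) (X : Set B) : Prop :=
  ∀ Y₁ Y₂ : Set B, Y₁ ⊆ X → Y₂ ⊆ X → ∀ g : ArtinGroup M,
    (fun x => g⁻¹ * x * g) '' (σ M '' Y₁) = σ M '' Y₂ →
    ∃ h ∈ AP M X, ∀ y ∈ Y₁, h⁻¹ * σ M y * h = g⁻¹ * σ M y * g

/-- Adjacency in the Coxeter graph: `s` and `t` are joined by an edge iff `m_{s,t} ≥ 3`
(where the value `0` codes `∞`, which also gives an edge). -/
def Adj (M : CoxeterMatrix B) (s t : B) : Prop := s ≠ t ∧ M s t ≠ 2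

/-- `s` and `t` are connected by a path of the Coxeter graph staying inside `X`. -/
def ReachIn (M : CoxeterMatrix B) (X : Set B) (s t : B) : Prop :=
  Relation.ReflTransGen (fun a b => a ∈ X ∧ b ∈ X ∧ Adj M a b) s t

/-- The Coxeter graph induced on `X` is connected. -/
def ConnectedIn (M : CoxeterMatrix B) (X : Set B) : Prop :=
  ∀ s ∈ X, ∀ t ∈ X, ReachIn M X s t

/-- The Coxeter matrix `M` restricted to `X` is of the type of the Coxeter matrix `M'`,
i.e. there is a bijection transporting one to the other. -/
def IsOfType {B' : Type*} (M : CoxeterMatrix B) (X : Set B) (M' : CoxeterMatrix B') : Prop :=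
  ∃ e : X ≃ B', ∀ a b : X, M a.val b.val = M' (e a) (e b)

/-- The Coxeter matrix of type `Bₙ` with the paper's labelling: vertices `0, …, n-1`
(representing `s_1, …, s_n`), `m_{s_1, s_2} = 4` and `m_{s_i, s_{i+1}} = 3` for `i ≥ 2`. -/
def Bmat (n : ℕ) : CoxeterMatrix (Fin n) where
  M := Matrix.of fun i j : Fin n ↦
    if i = j then 1
      else (if (i.val = 0 ∧ j.val = 1) ∨ (j.val = 0 ∧ i.val = 1) then 4
        else (if (j : ℕ) + 1 = i ∨ (i : ℕ) + 1 = j then 3 else 2))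
  isSymm := by unfold Matrix.IsSymm; aesop
  diagonal := by simp
  off_diagonal := by aesop

/-- The Coxeter matrix of type `Dₙ` with the paper's labelling: vertices `0, …, n-1`
(representing `s_1, …, s_n`), with edges `{s_1, s_3}`, `{s_2, s_3}` and `{s_i, s_{i+1}}`
for `i ≥ 3`, all labelled `3`. -/
def Dmat (n : ℕ) : CoxeterMatrix (Fin n) where
  M := Matrix.of fun i j : Fin n ↦
    if i = j then 1
      else (if (i.val = 0 ∧ j.val = 2) ∨ (j.val = 0 ∧ i.val = 2) then 3
        else (if i.val = 0 ∨ j.val = 0 then 2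
          else (if (j : ℕ) + 1 = i ∨ (i : ℕ) + 1 = j then 3 else 2)))
  isSymm := by unfold Matrix.IsSymm; aesop
  diagonal := by simp
  off_diagonal := by aesop

end ArtinTits


namespace ArtinTits

open Polynomial.Chebyshev in
theorem refl_pow_eq_one {V : Type*} [AddCommGroup V] [Module ℝ V] {x y : V}
    {f g : Module.Dual ℝ V} (hf : f x = 2) (hg : g y = 2) (m : ℕ) (hm : 2 ≤ m)
    (hfy : f y = -2 * Real.cos (Real.pi / m)) (hgx : g x = -2 * Real.cos (Real.pi / m)) :
    (Module.reflection hf * Module.reflection hg) ^ m = 1 := by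
  have ht : (2 * Real.cos (2 * Real.pi / m) : ℝ) = f y * g x - 2 := by
    rw [hfy, hgx, show 2 * Real.pi / m = 2 * (Real.pi / m) by ring, Real.cos_two_mul]; ring
  have hm0 : (m : ℝ) ≠ 0 := by positivity
  ext z
  rw [Module.reflection_mul_reflection_pow_apply hf hg m z _ ht]
  simp only [LinearEquiv.coe_one, id_eq]
  rcases eq_or_lt_of_le hm with h2 | h3
  · subst h2
    have e1 : f y = 0 := by rw [hfy]; simp
    have e2 : g x = 0 := by rw [hgx]; simp
    rw [e1, e2]
    have : (2 * Real.cos (2 * Real.pi / (2:ℕ)) : ℝ) = -2 := by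
      simp
    rw [this]
    norm_num
    module
  · set θ := 2 * Real.pi / m with hθ
    have hs : Real.sin θ ≠ 0 := by
      apply ne_of_gt
      apply Real.sin_pos_of_pos_of_lt_pi
      · positivity
      · rw [hθ, div_lt_iff₀ (by positivity)]
        have : (3:ℝ) ≤ m := by exact_mod_cast h3
        nlinarith [Real.pi_pos]
    have hmθ : (m : ℝ) * θ = 2 * Real.pi := by rw [hθ]; field_simp
    rcases Nat.even_or_odd' m with ⟨q, hq | hq⟩
    · have hS : (S ℝ ((q:ℤ) - 1)).eval (2 * Real.cos θ) = 0 := by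
        have := S_two_mul_real_cos θ ((q:ℤ) - 1)
        have h1 : (((q:ℤ) - 1 : ℤ) + 1 : ℝ) * θ = Real.pi := by
          push_cast
          rw [hq] at hmθ
          push_cast at hmθ
          linarith
        rw [h1, Real.sin_pi] at this
        exact (mul_eq_zero.mp this).resolve_right hs
      rw [show ((m:ℤ) - 2) / 2 = (q:ℤ) - 1 by omega, show ((m:ℤ) - 1) / 2 = (q:ℤ) - 1 by omega, hS]
      simp
    · have hS : (S ℝ (q:ℤ)).eval (2 * Real.cos θ) + (S ℝ ((q:ℤ) - 1)).eval (2 * Real.cos θ) = 0 := by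
        have h1 := S_two_mul_real_cos θ ((q:ℤ) - 1)
        have h2 := S_two_mul_real_cos θ (q:ℤ)
        have e1 : (((q:ℤ) - 1 : ℤ) + 1 : ℝ) * θ = q * θ := by
          push_cast
          ring
        have e2 : ((q:ℤ) + 1 : ℝ) * θ = 2 * Real.pi - q * θ := by
          rw [hq] at hmθ
          push_cast at hmθ ⊢
          linarith
        rw [e1] at h1
        rw [e2, Real.sin_two_pi_sub] at h2
        have h3 : ((S ℝ (q:ℤ)).eval (2 * Real.cos θ) + (S ℝ ((q:ℤ) - 1)).eval (2 * Real.cos θ)) * Real.sin θ = 0 := by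
          rw [add_mul, h1, h2]; ring
        simpa [hs] using h3
      rw [show ((m:ℤ) - 2) / 2 = (q:ℤ) - 1 by omega, show ((m:ℤ) - 1) / 2 = (q:ℤ) by omega,
        show ((m:ℤ) - 3) / 2 = (q:ℤ) - 1 by omega, show (m:ℤ) / 2 = (q:ℤ) by omega, hS]
      simp

open Polynomial.Chebyshev in
theorem dvd_of_refl_pow {V : Type*} [AddCommGroup V] [Module ℝ V] {x y : V}
    {f g : Module.Dual ℝ V} (hf : f x = 2) (hg : g y = 2) (m : ℕ) (hm : m ≠ 1)
    (hfy : f y = -2 * Real.cos (Real.pi / m)) (hgx : g x = -2 * Real.cos (Real.pi / m))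
    (hind : ∀ a b : ℝ, a • x + b • y = x → a = 1 ∧ b = 0)
    (k : ℕ) (hk : (Module.reflection hf * Module.reflection hg) ^ k = 1) : m ∣ k := by
  have ht : (2 * Real.cos (2 * Real.pi / m) : ℝ) = f y * g x - 2 := by
    rw [hfy, hgx, show 2 * Real.pi / m = 2 * (Real.pi / m) by ring, Real.cos_two_mul]; ring
  have h := Module.reflection_mul_reflection_pow_apply_self hf hg k _ ht
  rw [hk, LinearEquiv.coe_one, id] at h
  obtain ⟨h1, h2⟩ := hind _ _ h.symm
  rcases Nat.eq_zero_or_pos m with h0 | hpos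
  · subst h0
    rw [hgx] at h2
    simp [S_eval_two] at h2
    simp [h2]
  rcases eq_or_lt_of_le (show 2 ≤ m by omega) with h2' | h3
  · subst h2'
    have : (2 * Real.cos (2 * Real.pi / (2:ℕ)) : ℝ) = -2 := by
      simp
    rw [this, S_eval_neg_two, S_eval_neg_two] at h1
    rcases Nat.even_or_odd k with he | ho
    · exact he.two_dvd
    · exfalso
      rw [Int.negOnePow_sub, Int.negOnePow_odd _ (by exact_mod_cast ho)] at h1
      push_cast at h1
      simp at h1
      linarith
  · have hm0 : (m : ℝ) ≠ 0 := by positivity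
    have h3' : (3:ℝ) ≤ m := by exact_mod_cast h3
    have hc : g x ≠ 0 := by
      rw [hgx]
      have : 0 < Real.cos (Real.pi / m) := by
        apply Real.cos_pos_of_mem_Ioo
        constructor
        · have : 0 < Real.pi / m := by positivity
          linarith [Real.pi_pos]
        · rw [div_lt_div_iff₀ (by positivity) (by positivity)]
          nlinarith [Real.pi_pos]
      simpa using this.ne'
    set θ := 2 * Real.pi / m with hθ
    have hs : Real.sin θ ≠ 0 := by
      apply ne_of_gt
      apply Real.sin_pos_of_pos_of_lt_pi
      · positivity
      · rw [hθ, div_lt_iff₀ (by positivity)]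
        nlinarith [Real.pi_pos]
    have h2'' : (S ℝ ((k:ℤ) - 1)).eval (2 * Real.cos θ) = 0 := by
      simpa [hc] using h2
    rw [h2'', add_zero] at h1
    have e1 := S_two_mul_real_cos θ ((k:ℤ) - 1)
    have e2 := S_two_mul_real_cos θ (k:ℤ)
    rw [h2'', zero_mul, show (((k:ℤ) - 1 : ℤ) + 1 : ℝ) * θ = k * θ by push_cast; ring] at e1
    rw [h1, one_mul, show ((k:ℤ) + 1 : ℝ) * θ = k * θ + θ by push_cast; ring, Real.sin_add, ← e1,
      zero_mul, zero_add] at e2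
    have hcos : Real.cos (k * θ) = 1 := by
      have := mul_right_cancel₀ hs ((one_mul _).trans e2)
      exact this.symm
    rw [Real.cos_eq_one_iff] at hcos
    obtain ⟨n, hn⟩ := hcos
    have : (n : ℝ) * m = k := by
      rw [hθ] at hn
      field_simp at hn
      have hp := Real.pi_pos.ne'
      linarith
    have h' : (n * m : ℤ) = k := by exact_mod_cast this
    exact Int.natCast_dvd_natCast.mp ⟨n, by rw [← h']; ring⟩

variable {B : Type*}

theorem dvd_of_simple_pow [Finite B] (M : CoxeterMatrix B) (i j : B) (k : ℕ)
    (hk : (M.simple i * M.simple j) ^ k = 1) : M i j ∣ k := by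
  classical
  rcases eq_or_ne i j with rfl | hij
  · simp
  cases nonempty_fintype B
  let K : B → B → ℝ := fun i j => -2 * Real.cos (Real.pi / (M i j))
  let f : B → Module.Dual ℝ (B → ℝ) := fun i => ∑ j, K i j • LinearMap.proj j
  let x : B → (B → ℝ) := fun i => Pi.single i 1
  have hfx : ∀ i j, f i (x j) = K i j := by
    intro i j
    simp [f, x, LinearMap.sum_apply, Pi.single_apply]
  have hff : ∀ i, f i (x i) = 2 := by
    intro i
    rw [hfx]; simp [K]
  have hl : M.IsLiftable (fun i => Module.reflection (hff i)) := by
    intro i j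
    rcases eq_or_ne i j with rfl | hij
    · rw [M.diagonal, pow_one]
      exact Module.involutive_reflection (hff i) |> fun h => LinearEquiv.ext h
    · rcases Nat.eq_zero_or_pos (M i j) with h0 | hpos
      · rw [h0, pow_zero]
      · have := M.off_diagonal i j hij
        apply refl_pow_eq_one (hff i) (hff j) (M i j) (by omega)
        · rw [hfx]
        · rw [hfx]; simp only [K]; rw [M.symmetric]
  have h1 := congrArg (M.toCoxeterSystem.lift ⟨_, hl⟩) hk
  rw [map_pow, map_mul, map_one, ← CoxeterMatrix.toCoxeterSystem_simple,
    CoxeterSystem.lift_apply_simple, CoxeterSystem.lift_apply_simple] at h1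
  refine dvd_of_refl_pow (hff i) (hff j) (M i j) (M.off_diagonal i j hij) ?_ ?_ ?_ k h1
  · rw [hfx]
  · rw [hfx]; simp only [K]; rw [M.symmetric]
  · intro a b h
    have h1 := congrFun h i
    have h2 := congrFun h j
    simp [x, hij, hij.symm] at h1 h2
    exact ⟨h1, h2⟩

theorem M_ne_zero [Finite B] (M : CoxeterMatrix B) [Finite M.Group] (i j : B) : M i j ≠ 0 := by
  intro h
  have := dvd_of_simple_pow M i j _ (pow_orderOf_eq_one (M.simple i * M.simple j))
  rw [h, zero_dvd_iff] at this
  exact (orderOf_pos _).ne' this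

theorem simple_inj [Finite B] (M : CoxeterMatrix B) {i j : B} (h : M.simple i = M.simple j) :
    i = j := by
  by_contra hij
  have := dvd_of_simple_pow M i j 1 (by
    rw [h, pow_one]; exact M.toCoxeterSystem.simple_mul_simple_self j)
  exact M.off_diagonal i j hij (Nat.dvd_one.mp this)

end ArtinTits


namespace ArtinTits

section CoxeterTheory

variable {B : Type*} {M : CoxeterMatrix B}

/-- The length function on the Coxeter group. -/
noncomputable def ln (w : M.Group) : ℕ := M.toCoxeterSystem.length w

theorem ln_one : ln (1 : M.Group) = 0 := M.toCoxeterSystem.length_one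

theorem ln_inv (w : M.Group) : ln w⁻¹ = ln w := M.toCoxeterSystem.length_inv w

theorem ln_mul_le (u v : M.Group) : ln (u * v) ≤ ln u + ln v := M.toCoxeterSystem.length_mul_le u v

theorem ln_s (i : B) : ln (M.simple i) = 1 := M.toCoxeterSystem.length_simple i

theorem ln_s_mul (w : M.Group) (i : B) :
    ln (M.simple i * w) = ln w + 1 ∨ ln (M.simple i * w) + 1 = ln w :=
  M.toCoxeterSystem.length_simple_mul w i

theorem ln_mul_s (w : M.Group) (i : B) :
    ln (w * M.simple i) = ln w + 1 ∨ ln (w * M.simple i) + 1 = ln w :=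
  M.toCoxeterSystem.length_mul_simple w i

theorem ln_eq_zero {w : M.Group} : ln w = 0 ↔ w = 1 := M.toCoxeterSystem.length_eq_zero_iff

theorem ln_eq_one {w : M.Group} : ln w = 1 ↔ ∃ i, w = M.simple i :=
  M.toCoxeterSystem.length_eq_one_iff

theorem exists_left_desc {w : M.Group} (hw : w ≠ 1) : ∃ i, ln (M.simple i * w) < ln w :=
  M.toCoxeterSystem.exists_leftDescent_of_ne_one hw

theorem exists_right_desc {w : M.Group} (hw : w ≠ 1) : ∃ i, ln (w * M.simple i) < ln w :=
  M.toCoxeterSystem.exists_rightDescent_of_ne_one hw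

@[simp] theorem s_mul_s (i : B) : M.simple i * M.simple i = 1 :=
  M.toCoxeterSystem.simple_mul_simple_self i

@[simp] theorem s_mul_s_mul (i : B) (w : M.Group) : M.simple i * (M.simple i * w) = w :=
  M.toCoxeterSystem.simple_mul_simple_cancel_left i

@[simp] theorem mul_s_mul_s (i : B) (w : M.Group) : w * M.simple i * M.simple i = w :=
  M.toCoxeterSystem.simple_mul_simple_cancel_right i

@[simp] theorem s_inv (i : B) : (M.simple i)⁻¹ = M.simple i :=
  M.toCoxeterSystem.inv_simple i

theorem s_pow (i j : B) : (M.simple i * M.simple j) ^ M i j = 1 :=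
  M.toCoxeterSystem.simple_mul_simple_pow i j

theorem w_induction {p : M.Group → Prop} (w : M.Group) (one : p 1)
    (step : ∀ w i, p w → p (M.simple i * w)) : p w :=
  M.toCoxeterSystem.simple_induction_left w one step

/-- Induction on length, peeling off a letter on the left. -/
theorem ln_induction {p : M.Group → Prop} (one : p 1)
    (step : ∀ w i, ln (M.simple i * w) = ln w + 1 → p w → p (M.simple i * w)) (w : M.Group) : p w := by
  induction h : ln w generalizing w with
  | zero => rw [ln_eq_zero.mp h]; exact one
  | succ n ih =>
    have hw : w ≠ 1 := by
      rintro rfl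
      rw [ln_one] at h; omega
    obtain ⟨i, hi⟩ := exists_left_desc hw
    have h1 := ln_s_mul w i
    have := step (M.simple i * w) i (by rw [s_mul_s_mul]; omega) (ih _ (by omega))
    rwa [s_mul_s_mul] at this

/-- Induction on length, peeling off a letter on the right. -/
theorem ln_induction_right {p : M.Group → Prop} (one : p 1)
    (step : ∀ w i, ln (w * M.simple i) = ln w + 1 → p w → p (w * M.simple i)) (w : M.Group) : p w := by
  have : ∀ w : M.Group, p w⁻¹ := ln_induction (by simpa using one) (by
    intro w i h1 h2
    rw [mul_inv_rev, s_inv]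
    apply step _ _ _ h2
    rw [← ln_inv, mul_inv_rev, inv_inv, s_inv, h1, ln_inv])
  simpa using this w⁻¹

theorem end_mul {α : Type*} (f g : Function.End α) (x : α) : (f * g) x = f (g x) := rfl

theorem end_one {α : Type*} (x : α) : (1 : Function.End α) x = x := rfl

open Classical in
/-- The generators of the action on `W × ℤ/2`. -/
noncomputable def phiGen (i : B) : Function.End (M.Group × ZMod 2) :=
  fun p => (M.simple i * p.1 * M.simple i, p.2 + if p.1 = M.simple i then 1 else 0)

theorem mul_pow_comm' {G : Type*} [Monoid G] (a b : G) (n : ℕ) : (a * b) ^ n * a = a * (b * a) ^ n := by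
  induction n with
  | zero => simp
  | succ n ih => rw [pow_succ, pow_succ, mul_assoc, mul_assoc a b a, ← mul_assoc _ a, ih]; simp [mul_assoc]

open Classical in
theorem phiGen_pow (i j : B) (n : ℕ) (p : M.Group × ZMod 2) :
    ((phiGen i * phiGen j : Function.End (M.Group × ZMod 2)) ^ n) p =
      ((M.simple i * M.simple j) ^ n * p.1 * ((M.simple i * M.simple j) ^ n)⁻¹,
        p.2 + ∑ l ∈ Finset.range (2 * n),
          if p.1 = ((M.simple i * M.simple j) ^ l)⁻¹ * M.simple j then 1 else 0) := by
  induction n with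
  | zero => simp [end_one]
  | succ n ih =>
    rw [pow_succ', end_mul, ih]
    set c := M.simple i * M.simple j with hc
    have hjc : ∀ n : ℕ, M.simple j * c ^ n = (c ^ n)⁻¹ * M.simple j := by
      intro n
      have : c⁻¹ = M.simple j * M.simple i := by simp [hc]
      rw [← inv_pow, this, hc, mul_pow_comm']
    have e1 : ∀ q : M.Group, c ^ n * q * (c ^ n)⁻¹ = M.simple j ↔
        q = (c ^ (2 * n))⁻¹ * M.simple j := by
      intro q
      rw [mul_inv_eq_iff_eq_mul, ← eq_inv_mul_iff_mul_eq, hjc, ← mul_assoc, ← mul_inv_rev, ← pow_add, two_mul]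
    have e2 : ∀ q : M.Group, M.simple j * (c ^ n * q * (c ^ n)⁻¹) * M.simple j = M.simple i ↔
        q = (c ^ (2 * n + 1))⁻¹ * M.simple j := by
      intro q
      have : M.simple j * (c ^ n * q * (c ^ n)⁻¹) * M.simple j = M.simple i ↔
         c ^ n * q * (c ^ n)⁻¹ = M.simple j * M.simple i * M.simple j := by
        constructor
        · intro h; rw [← h]; simp [mul_assoc]
        · intro h; rw [h]; simp [mul_assoc]
      rw [this, mul_inv_eq_iff_eq_mul, ← eq_inv_mul_iff_mul_eq, mul_assoc (_ * _), hjc]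
      have h3 : M.simple j * M.simple i = c⁻¹ := by simp [hc]
      rw [h3, show 2 * n + 1 = n + (1 + n) by ring, pow_add, pow_add, pow_one]
      simp [mul_assoc]
    simp only [phiGen, end_mul]
    rw [show 2 * (n + 1) = 2 * n + 1 + 1 by ring, Finset.sum_range_succ, Finset.sum_range_succ]
    refine Prod.ext ?_ ?_
    · simp [pow_succ', hc, mul_assoc]
    · simp only [e1, e2]
      ring

theorem phiGen_liftable : M.IsLiftable (phiGen (M := M)) := by
  classical
  intro i j
  funext p
  rw [phiGen_pow, s_pow]
  refine Prod.ext (by simp [end_one]) ?_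
  rw [two_mul, Finset.sum_range_add]
  simp only [pow_add, s_pow, one_mul]
  rw [CharTwo.add_self_eq_zero]
  simp [end_one]

/-- The homomorphism giving the action on `W × ℤ/2`. -/
noncomputable def phi : M.Group →* Function.End (M.Group × ZMod 2) :=
  M.toCoxeterSystem.lift ⟨phiGen, phiGen_liftable⟩

theorem phi_s (i : B) : phi (M.simple i) = phiGen i :=
  M.toCoxeterSystem.lift_apply_simple phiGen_liftable i

/-- The left inversion cocycle. -/
noncomputable def lam (w t : M.Group) : ZMod 2 := (phi w⁻¹ (t, 0)).2

theorem phi_apply (w t : M.Group) (e : ZMod 2) :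
    phi w⁻¹ (t, e) = (w⁻¹ * t * w, e + lam w t) := by
  have key : ∀ (w t : M.Group) (e : ZMod 2), phi w (t, e) = (w * t * w⁻¹, e + (phi w (t, 0)).2) := by
    intro w
    induction w using w_induction with
    | one => simp [end_one]
    | step w i ih =>
      intro t e
      rw [map_mul, end_mul, end_mul, ih t e, ih t 0, phi_s]
      simp [phiGen, mul_assoc, add_assoc]
  rw [key, inv_inv]; rfl

theorem lam_mul (u v t : M.Group) : lam (u * v) t = lam u t + lam v (u⁻¹ * t * u) := by
  have := phi_apply v (u⁻¹ * t * u) (lam u t)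
  unfold lam at this ⊢
  rw [mul_inv_rev, map_mul, end_mul, phi_apply u t 0, zero_add]
  unfold lam
  rw [this]

open Classical in
theorem lam_s (i : B) (t : M.Group) : lam (M.simple i) t = if t = M.simple i then 1 else 0 := by
  unfold lam
  rw [s_inv, phi_s]
  simp [phiGen]

theorem lam_one (t : M.Group) : lam 1 t = 0 := by
  unfold lam
  simp [end_one]

theorem zmod2_ne {x : ZMod 2} : x ≠ 0 ↔ x = 1 := by
  revert x; decide

theorem zmod2_ne' {x : ZMod 2} : x ≠ 1 ↔ x = 0 := by
  revert x; decide

theorem lam_word (ω : List B) (t : M.Group) (h : lam ((ω.map M.simple).prod) t ≠ 0) :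
    ∃ ω' : List B, ω'.length + 1 = ω.length ∧
      (ω'.map M.simple).prod = t⁻¹ * (ω.map M.simple).prod := by
  classical
  induction ω generalizing t with
  | nil => simp [lam_one] at h
  | cons i ω ih =>
    rw [List.map_cons, List.prod_cons, lam_mul, lam_s] at h
    by_cases ht : t = M.simple i
    · refine ⟨ω, by simp, ?_⟩
      subst ht; simp
    · rw [if_neg ht, zero_add] at h
      obtain ⟨ω', h1, h2⟩ := ih _ h
      refine ⟨i :: ω', by simp [h1], ?_⟩
      rw [List.map_cons, List.prod_cons, h2]
      simp [mul_assoc]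

theorem lam_lt {w t : M.Group} (h : lam w t ≠ 0) : ln (t⁻¹ * w) < ln w := by
  obtain ⟨ω, hω, hw⟩ := M.toCoxeterSystem.exists_isReduced w
  have hw' : w = (ω.map M.simple).prod := hw
  rw [hw'] at h
  obtain ⟨ω', h1, h2⟩ := lam_word ω t h
  rw [← hw'] at h2
  rw [← h2]
  have h3 : ln ((ω'.map M.simple).prod) ≤ ω'.length := M.toCoxeterSystem.length_wordProd_le ω'
  have h4 : ln w = ω.length := by rw [hw]; exact hω
  omega

theorem lam_s_iff {w : M.Group} {i : B} : lam w (M.simple i) = 1 ↔ ln (M.simple i * w) < ln w := by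
  constructor
  · intro h
    have := lam_lt (zmod2_ne.mpr h)
    rwa [s_inv] at this
  · intro h
    by_contra h1
    rw [← ne_eq, zmod2_ne'] at h1
    have : lam (M.simple i * w) (M.simple i) ≠ 0 := by
      rw [lam_mul, lam_s]; simp [h1]
    have := lam_lt this
    simp at this
    omega

theorem lam_s_iff' {w : M.Group} {i : B} :
    lam w (M.simple i) = 0 ↔ ln (M.simple i * w) = ln w + 1 := by
  rw [← zmod2_ne', ne_eq, lam_s_iff]
  have := ln_s_mul w i
  omega

/-- The exchange property. -/
theorem exchange {s b : B} {p : M.Group} (h1 : ln (M.simple s * p) = ln p + 1)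
    (h2 : ln (M.simple s * (p * M.simple b)) < ln (p * M.simple b)) :
    M.simple s * p = p * M.simple b := by
  classical
  rw [← lam_s_iff, lam_mul, lam_s_iff'.mpr h1, zero_add, lam_s] at h2
  split_ifs at h2 with h
  · rw [← h]; simp [mul_assoc]
  · simp at h2

end CoxeterTheory
end ArtinTits


namespace ArtinTits

section Dihedral

variable {B : Type*} {M : CoxeterMatrix B}

theorem altProd_zero {G : Type*} [Monoid G] (a b : G) : altProd a b 0 = 1 := rfl

theorem altProd_succ {G : Type*} [Monoid G] (a b : G) (n : ℕ) :
    altProd a b (n + 1) = a * altProd b a n := rfl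

theorem map_altProd {G H : Type*} [Monoid G] [Monoid H] (f : G →* H) (a b : G) (n : ℕ) :
    f (altProd a b n) = altProd (f a) (f b) n := by
  induction n generalizing a b with
  | zero => simp [altProd_zero]
  | succ n ih => rw [altProd_succ, altProd_succ, map_mul, ih]

theorem altProd_two_mul_add {G : Type*} [Monoid G] (a b : G) (q r : ℕ) :
    altProd a b (2 * q + r) = (a * b) ^ q * altProd a b r := by
  induction q with
  | zero => simp
  | succ q ih =>
    rw [show 2 * (q + 1) + r = 2 * q + r + 1 + 1 by ring, altProd_succ, altProd_succ, ih, pow_succ']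
    simp [mul_assoc]

/-- The alternating product in the Coxeter group. -/
def P (M : CoxeterMatrix B) (a b : B) (k : ℕ) : M.Group := altProd (M.simple a) (M.simple b) k

theorem P_zero (a b : B) : P M a b 0 = 1 := rfl

theorem P_succ (a b : B) (k : ℕ) : P M a b (k + 1) = M.simple a * P M b a k := rfl

theorem P_sub (a b : B) (k : ℕ) (hk : k ≤ 2 * M a b) : P M a b k = P M b a (2 * M a b - k) := by
  induction k generalizing a b with
  | zero =>
    have := altProd_two_mul_add (M.simple b) (M.simple a) (M b a) 0
    rw [s_pow, altProd_zero, mul_one, add_zero, M.symmetric] at this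
    exact this.symm
  | succ k ih =>
    rw [P_succ, ih b a (by rw [M.symmetric]; omega), M.symmetric b a,
      show 2 * M a b - k = 2 * M a b - (k + 1) + 1 by omega, P_succ, s_mul_s_mul]

theorem P_M (a b : B) : P M a b (M a b) = P M b a (M a b) := by
  rw [P_sub a b _ (by omega), show 2 * M a b - M a b = M a b by omega]

theorem lam_P (a b : B) (k : ℕ) (x : M.Group) (h : lam (P M a b k) x ≠ 0) :
    ∃ j < k, x = (M.simple a * M.simple b) ^ j * M.simple a := by
  classical
  induction k generalizing a b x with
  | zero => simp [P_zero, lam_one] at h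
  | succ k ih =>
    rw [P_succ, lam_mul, lam_s] at h
    by_cases hx : x = M.simple a
    · exact ⟨0, by omega, by simp [hx]⟩
    · rw [if_neg hx, zero_add] at h
      obtain ⟨j, hj, h1⟩ := ih _ _ _ h
      refine ⟨j + 1, by omega, ?_⟩
      rw [mul_pow_comm', pow_succ, ← mul_assoc _ (M.simple b), ← h1]
      simp [mul_assoc]

theorem P_dvd [Finite B] {a b : B} {j : ℕ}
    (h : M.simple b = (M.simple a * M.simple b) ^ j * M.simple a) : M a b ∣ j + 1 := by
  apply dvd_of_simple_pow
  rw [pow_succ, ← mul_assoc, ← h, s_mul_s]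

theorem ln_P_mul [Finite B] (H : Subgroup M.Group) (w' : M.Group)
    (hw : ∀ q ∈ H, lam w' q = 0) (a b : B) (ha : M.simple a ∈ H)
    (hb : M.simple b ∈ H) (k : ℕ) (hk : k ≤ M a b) :
    ln (P M a b k * w') = k + ln w' := by
  have hPH : ∀ (k : ℕ) (a b : B), M.simple a ∈ H → M.simple b ∈ H → P M a b k ∈ H := by
    intro k
    induction k with
    | zero => intro a b _ _; exact H.one_mem
    | succ k ih => intro a b h1 h2; exact H.mul_mem h1 (ih b a h2 h1)
  induction k generalizing a b with
  | zero => simp [P_zero]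
  | succ k ih =>
    have h0 : lam (P M b a k * w') (M.simple a) = 0 := by
      rw [lam_mul, hw _ (H.mul_mem (H.mul_mem (H.inv_mem (hPH k b a hb ha)) ha) (hPH k b a hb ha)), add_zero]
      by_contra hne
      obtain ⟨j, hj, h1⟩ := lam_P _ _ _ _ hne
      have := Nat.le_of_dvd (by omega) (P_dvd h1)
      rw [M.symmetric] at this
      omega
    rw [P_succ, mul_assoc, lam_s_iff'.mp h0, ih b a hb ha (by rw [M.symmetric]; omega)]
    ring

theorem ln_P [Finite B] (a b : B) (k : ℕ) (hk : k ≤ M a b) : ln (P M a b k) = k := by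
  have := ln_P_mul (M := M) ⊤ 1 (fun q _ => lam_one q) a b trivial trivial k hk
  simpa [ln_one] using this

/-- The fundamental dihedral lemma. -/
theorem dihedral [Finite B] [Finite M.Group] {s t : B} {w : M.Group}
    (hs : ln (M.simple s * w) < ln w) (ht : ln (M.simple t * w) < ln w) :
    ∃ w', w = P M s t (M s t) * w' ∧
      ∀ k ≤ M s t, ln (P M s t k * w') = k + ln w' ∧ ln (P M t s k * w') = k + ln w' := by
  classical
  let H : Subgroup M.Group := Subgroup.closure {M.simple s, M.simple t}
  have hsH : M.simple s ∈ H := Subgroup.subset_closure (by simp)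
  have htH : M.simple t ∈ H := Subgroup.subset_closure (by simp)
  have hform : ∀ u ∈ H, ∃ k, u = P M s t k ∨ u = P M t s k := by
    have step : ∀ (a b : B) (y : M.Group), (∃ k, y = P M a b k ∨ y = P M b a k) →
        ∃ k, M.simple a * y = P M a b k ∨ M.simple a * y = P M b a k := by
      rintro a b y ⟨k, rfl | rfl⟩
      · cases k with
        | zero => exact ⟨1, Or.inl (by simp [P_zero, P_succ])⟩
        | succ k => exact ⟨k, Or.inr (by simp [P_succ])⟩
      · exact ⟨k + 1, Or.inl rfl⟩
    have step' : ∀ x ∈ ({M.simple s, M.simple t} : Set M.Group), ∀ (y : M.Group),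
        (∃ k, y = P M s t k ∨ y = P M t s k) → ∃ k, x * y = P M s t k ∨ x * y = P M t s k := by
      intro x hx y hy
      rcases hx with rfl | hx
      · exact step _ _ _ hy
      · rw [Set.mem_singleton_iff.mp hx]
        obtain ⟨k, hk⟩ := step t s y (by obtain ⟨k, hk⟩ := hy; exact ⟨k, hk.symm⟩)
        exact ⟨k, hk.symm⟩
    intro u hu
    induction hu using Subgroup.closure_induction_left with
    | one => exact ⟨0, Or.inl rfl⟩
    | mul_left x hx y _ ih => exact step' x hx y ih
    | inv_mul_cancel x hx y _ ih =>
      have : x⁻¹ = x := by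
        rcases hx with rfl | hx
        · simp
        · rw [Set.mem_singleton_iff.mp hx]; simp
      rw [this]; exact step' x hx y ih
  obtain ⟨w', ⟨u, hu, hw⟩, hmin⟩ : ∃ w', (∃ u ∈ H, w = u * w') ∧
      ∀ w'', (∃ u ∈ H, w = u * w'') → ln w' ≤ ln w'' := by
    have hne : {w' | ∃ u ∈ H, w = u * w'}.Nonempty := ⟨w, 1, H.one_mem, by simp⟩
    obtain ⟨w', h1, h2⟩ := exists_minimalFor_of_wellFoundedLT (fun w' => ∃ u ∈ H, w = u * w') ln hne
    refine ⟨w', h1, fun w'' h => ?_⟩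
    by_contra hlt
    exact hlt (h2 h (by omega))
  have hlam : ∀ q ∈ H, lam w' q = 0 := by
    intro q hq
    by_contra hne
    have h1 := lam_lt hne
    have h2 := hmin (q⁻¹ * w') ⟨u * q, H.mul_mem hu hq, by rw [hw]; simp [mul_assoc]⟩
    omega
  have hlamu : ∀ q ∈ H, lam w q = lam u q := by
    intro q hq
    rw [hw, lam_mul, hlam _ (H.mul_mem (H.mul_mem (H.inv_mem hu) hq) hu), add_zero]
  have main : ∀ a b : B, M.simple b ∈ H → ln (M.simple b * w) < ln w → ∀ k, u = P M a b k →
      (∀ k', u = P M a b k' ∨ u = P M b a k' → k ≤ k') → k = M a b := by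
    intro a b hbH hb k hk hkmin
    have hpos := Nat.pos_of_ne_zero (M_ne_zero M a b)
    have h1 : lam (P M a b k) (M.simple b) ≠ 0 := by
      rw [← hk, ← hlamu _ hbH, lam_s_iff.mpr hb]; decide
    obtain ⟨j, hj, h2⟩ := lam_P _ _ _ _ h1
    have h3 := Nat.le_of_dvd (by omega) (P_dvd h2)
    by_contra hne
    rcases le_or_gt k (2 * M a b) with h4 | h4
    · have := hkmin (2 * M a b - k) (Or.inr (by rw [hk]; exact P_sub a b k h4))
      omega
    · have := hkmin (k - 2 * M a b) (Or.inl (by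
        rw [hk]
        have := altProd_two_mul_add (M.simple a) (M.simple b) (M a b) (k - 2 * M a b)
        rw [s_pow, one_mul, show 2 * M a b + (k - 2 * M a b) = k by omega] at this
        exact this))
      omega
  have hex := hform u hu
  have huP : u = P M s t (M s t) := by
    have hmn : ∀ k', u = P M s t k' ∨ u = P M t s k' → Nat.find hex ≤ k' := fun k' h => Nat.find_min' hex h
    rcases Nat.find_spec hex with h | h
    · rw [main s t htH ht _ h hmn] at h; exact h
    · rw [main t s hsH hs _ h (fun k' h => hmn k' h.symm), P_M, M.symmetric] at h; exact h
  refine ⟨w', by rw [← huP]; exact hw, fun k hk => ⟨?_, ?_⟩⟩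
  · exact ln_P_mul H w' hlam s t hsH htH k hk
  · exact ln_P_mul H w' hlam t s htH hsH k (by rw [M.symmetric]; exact hk)

end Dihedral

end ArtinTits


namespace ArtinTits

/-- `z` is a least upper bound of `a` and `b` with respect to `le`. -/
def Lub {Q : Type*} (le : Q → Q → Prop) (a b z : Q) : Prop :=
  le a z ∧ le b z ∧ ∀ c, le a c → le b c → le z c

theorem poset_lub {Q : Type*} (le : Q → Q → Prop) (hrefl : ∀ a, le a a)
    (htrans : ∀ a b c, le a b → le b c → le a c) (rk : Q → ℕ)
    (hrk : ∀ a b, le a b → rk a ≤ rk b) (C : Q → Prop) (m : Q)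
    (hyp : ∀ p a b, le p a → le p b → le a m → le b m → C a → C b →
      a = p ∨ b = p ∨ ∃ a' b' z, le a' a ∧ le b' b ∧
        rk p < rk a' ∧ rk p < rk b' ∧ C z ∧ Lub le a' b' z)
    (p a b : Q) (hpa : le p a) (hpb : le p b) (ham : le a m) (hbm : le b m)
    (ha : C a) (hb : C b) : ∃ z, C z ∧ Lub le a b z := by
  induction hn : rk m - rk p using Nat.strong_induction_on generalizing p a b with
  | _ n ih =>
    rcases hyp p a b hpa hpb ham hbm ha hb with rfl | rfl | ⟨a', b', z, ha', hb', hra, hrb, hCz, hz⟩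
    · exact ⟨b, hb, hpb, hrefl b, fun c _ h => h⟩
    · exact ⟨a, ha, hrefl a, hpa, fun c h _ => h⟩
    · have ha'm := htrans _ _ _ ha' ham
      have hb'm := htrans _ _ _ hb' hbm
      have hzm := hz.2.2 m ha'm hb'm
      have r1 := hrk _ _ ha'm
      have r2 := hrk _ _ hb'm
      have r3 := hrk _ _ hzm
      have r4 := hrk _ _ hz.1
      obtain ⟨c, hCc, hc⟩ := ih (rk m - rk a') (by omega) a' a z ha' hz.1 ham hzm ha hCz rfl
      obtain ⟨c2, hCc2, hc2⟩ := ih (rk m - rk b') (by omega) b' z b hz.2.1 hb' hzm hbm hCz hb rfl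
      have hcm := hc.2.2 m ham hzm
      have hc2m := hc2.2.2 m hzm hbm
      obtain ⟨f, hCf, hf⟩ := ih (rk m - rk z) (by omega) z c c2 hc.2.1 hc2.1 hcm hc2m hCc hCc2 rfl
      refine ⟨f, hCf, htrans _ _ _ hc.1 hf.1, htrans _ _ _ hc2.2.1 hf.2.1, fun e hae hbe => ?_⟩
      have hze := hz.2.2 e (htrans _ _ _ ha' hae) (htrans _ _ _ hb' hbe)
      exact hf.2.2 e (hc.2.2 e hae hze) (hc2.2.2 e hze hbe)

section WeakOrder

variable {B : Type*} {M : CoxeterMatrix B}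

/-- The weak order. -/
def wle (x y : M.Group) : Prop := ln x + ln (x⁻¹ * y) = ln y

/-- The product `x v` is reduced. -/
def Red (x v : M.Group) : Prop := ln (x * v) = ln x + ln v

theorem wle_refl (x : M.Group) : wle x x := by simp [wle, ln_one]

theorem one_wle (x : M.Group) : wle 1 x := by simp [wle, ln_one]

theorem wle_trans {x y z : M.Group} (h1 : wle x y) (h2 : wle y z) : wle x z := by
  unfold wle at *
  have e1 := ln_mul_le (x⁻¹ * y) (y⁻¹ * z)
  have e2 := ln_mul_le x (x⁻¹ * z)
  rw [show x⁻¹ * y * (y⁻¹ * z) = x⁻¹ * z by group] at e1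
  rw [show x * (x⁻¹ * z) = z by group] at e2
  omega

theorem wle_ln {x y : M.Group} (h : wle x y) : ln x ≤ ln y := by unfold wle at h; omega

theorem wle_eq {x y : M.Group} (h : wle x y) (h' : ln y ≤ ln x) : x = y := by
  unfold wle at h
  have : ln (x⁻¹ * y) = 0 := by omega
  rw [ln_eq_zero] at this
  exact inv_mul_eq_one.mp this

theorem wle_mul_iff {x v : M.Group} : wle x (x * v) ↔ Red x v := by
  unfold wle Red
  rw [inv_mul_cancel_left]
  exact eq_comm

theorem red_s_iff {i : B} {w : M.Group} : Red (M.simple i) w ↔ ln (M.simple i * w) = ln w + 1 := by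
  unfold Red; rw [ln_s, add_comm]

theorem red_assoc {x y z : M.Group} (h1 : Red x y) (h2 : Red (x * y) z) :
    Red y z ∧ Red x (y * z) := by
  unfold Red at *
  have e1 := ln_mul_le y z
  have e2 := ln_mul_le x (y * z)
  rw [mul_assoc] at h2
  omega

theorem red_assoc' {x y z : M.Group} (h1 : Red y z) (h2 : Red x (y * z)) :
    Red x y ∧ Red (x * y) z := by
  unfold Red at *
  have e1 := ln_mul_le x y
  have e2 := ln_mul_le (x * y) z
  rw [mul_assoc] at e2 ⊢
  omega

theorem wle_mul_right_iff {x u v : M.Group} (hu : Red x u) (hv : Red x v) :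
    wle (x * u) (x * v) ↔ wle u v := by
  unfold wle Red at *
  rw [hu, hv, show (x * u)⁻¹ * (x * v) = u⁻¹ * v by group]
  omega

theorem lam_refl (v : M.Group) (i : B) :
    lam (v * M.simple i * v⁻¹) (v * M.simple i * v⁻¹) = 1 := by
  classical
  have h1 := lam_mul v v⁻¹ (v * M.simple i * v⁻¹)
  rw [mul_inv_cancel, lam_one, show v⁻¹ * (v * M.simple i * v⁻¹) * v = M.simple i by group] at h1
  rw [mul_assoc v, lam_mul, show v⁻¹ * (v * (M.simple i * v⁻¹)) * v = M.simple i by group, lam_mul, lam_s]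
  rw [mul_assoc v] at h1
  simp only [s_inv, s_mul_s, one_mul, if_true]
  rw [add_left_comm, ← h1, add_zero]

theorem exists_w0 (M : CoxeterMatrix B) [Finite M.Group] :
    ∃ w0 : M.Group, ∀ u, ln (u * w0) + ln u = ln w0 := by
  obtain ⟨w0, hw0⟩ := Finite.exists_max (ln : M.Group → ℕ)
  have hlam : ∀ v i, lam w0 (v * M.simple i * v⁻¹) = 1 := by
    intro v i
    by_contra h
    rw [← ne_eq, zmod2_ne'] at h
    set t := v * M.simple i * v⁻¹ with ht
    have h1 : lam (t * w0) t ≠ 0 := by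
      rw [lam_mul, lam_refl, inv_mul_cancel, one_mul, h]; decide
    have h2 := lam_lt h1
    rw [inv_mul_cancel_left] at h2
    have := hw0 (t * w0)
    omega
  refine ⟨w0, fun u => ?_⟩
  induction u using ln_induction with
  | one => simp [ln_one]
  | step u i hi ih =>
    have h1 : lam (u * w0) (M.simple i) = 1 := by
      rw [lam_mul, lam_s_iff'.mpr hi]
      have := hlam u⁻¹ i
      rw [inv_inv] at this
      rw [this, zero_add]
    have h2 := lam_s_iff.mp h1
    have h3 := ln_s_mul (u * w0) i
    rw [mul_assoc]
    omega

/-- The longest element. -/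
noncomputable def w0 (M : CoxeterMatrix B) [Finite M.Group] : M.Group := (exists_w0 M).choose

variable [Finite M.Group]

theorem ln_mul_w0 (u : M.Group) : ln (u * w0 M) + ln u = ln (w0 M) := (exists_w0 M).choose_spec u

theorem w0_mul_w0 : w0 M * w0 M = 1 := by
  have := ln_mul_w0 (w0 M)
  rw [← ln_eq_zero]; omega

theorem w0_inv : (w0 M)⁻¹ = w0 M := by
  rw [inv_eq_iff_mul_eq_one]; exact w0_mul_w0

theorem wle_w0 (u : M.Group) : wle u (w0 M) := by
  have := ln_mul_w0 u⁻¹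
  unfold wle
  rw [ln_inv] at this; omega

theorem red_iff {x v : M.Group} : Red x v ↔ wle v (x⁻¹ * w0 M) := by
  unfold Red wle
  have h1 := ln_mul_w0 (x * v)⁻¹
  have h2 := ln_mul_w0 x⁻¹
  rw [ln_inv] at h1 h2
  rw [show v⁻¹ * (x⁻¹ * w0 M) = (x * v)⁻¹ * w0 M by group]
  omega

theorem w0_conj (i : B) : ∃ j, w0 M * M.simple i * w0 M = M.simple j := by
  rw [← ln_eq_one]
  have h1 := ln_mul_w0 (w0 M * M.simple i)
  have h2 := ln_mul_w0 (M.simple i)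
  rw [← ln_inv (w0 M * _), mul_inv_rev, w0_inv, s_inv] at h1
  rw [ln_s] at h2
  omega

variable [Finite B]

theorem join_s (p : M.Group) (s t : B) (hs : Red p (M.simple s)) (ht : Red p (M.simple t)) :
    Lub wle (p * M.simple s) (p * M.simple t) (p * P M s t (M s t)) := by
  have key : ∀ w, Red p w → wle (p * M.simple s) (p * w) → wle (p * M.simple t) (p * w) →
      wle (p * P M s t (M s t)) (p * w) ∧ Red p (P M s t (M s t)) := by
    intro w hw h1 h2
    rw [wle_mul_right_iff hs hw] at h1
    rw [wle_mul_right_iff ht hw] at h2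
    unfold wle at h1 h2
    rw [s_inv, ln_s] at h1 h2
    obtain ⟨w', rfl, h3⟩ := dihedral (M := M) (s := s) (t := t) (w := w) (by omega) (by omega)
    have h4 := (h3 _ le_rfl).1
    have h5 : Red (P M s t (M s t)) w' := by unfold Red; rw [ln_P _ _ _ le_rfl, h4]
    have := red_assoc' h5 hw
    exact ⟨by rw [wle_mul_right_iff this.1 hw]; exact wle_mul_iff.mpr h5, this.1⟩
  have hRs : wle (M.simple s) (P M s t (M s t)) := by
    have h0 := Nat.pos_of_ne_zero (M_ne_zero M s t)
    obtain ⟨k, hk⟩ : ∃ k, M s t = k + 1 := ⟨M s t - 1, by omega⟩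
    have h1 := ln_P (M := M) s t (M s t) le_rfl
    have h2 := ln_P (M := M) t s k (by rw [M.symmetric]; omega)
    unfold wle
    rw [s_inv, ln_s, h1]
    rw [hk, P_succ, s_mul_s_mul, h2]; omega
  have hRt : wle (M.simple t) (P M s t (M s t)) := by
    have h0 := Nat.pos_of_ne_zero (M_ne_zero M s t)
    obtain ⟨k, hk⟩ : ∃ k, M s t = k + 1 := ⟨M s t - 1, by omega⟩
    have h1 := ln_P (M := M) s t (M s t) le_rfl
    have h2 := ln_P (M := M) s t k (by omega)
    unfold wle
    rw [s_inv, ln_s, h1]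
    rw [P_M, hk, P_succ, s_mul_s_mul, h2]; omega
  have hw0 := wle_w0 (M := M)
  have hp := (key (p⁻¹ * w0 M) (red_iff.mpr (wle_refl _)) (by rw [mul_inv_cancel_left]; exact hw0 _)
    (by rw [mul_inv_cancel_left]; exact hw0 _)).2
  refine ⟨(wle_mul_right_iff hs hp).mpr hRs, (wle_mul_right_iff ht hp).mpr hRt, fun c h1 h2 => ?_⟩
  have hpc : wle p c := wle_trans (wle_mul_iff.mpr hs) h1
  have hw : Red p (p⁻¹ * c) := by rw [← wle_mul_iff, mul_inv_cancel_left]; exact hpc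
  have := (key (p⁻¹ * c) hw (by rwa [mul_inv_cancel_left]) (by rwa [mul_inv_cancel_left])).1
  rwa [mul_inv_cancel_left] at this

theorem exists_step {p a : M.Group} (h : wle p a) (hne : a ≠ p) :
    ∃ s, Red p (M.simple s) ∧ wle (p * M.simple s) a := by
  have h1 : p⁻¹ * a ≠ 1 := fun h => hne (inv_mul_eq_one.mp h).symm
  obtain ⟨s, hs⟩ := exists_left_desc h1
  have h2 := ln_s_mul (p⁻¹ * a) s
  have hr : Red p (p⁻¹ * a) := by rw [← wle_mul_iff, mul_inv_cancel_left]; exact h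
  have hr2 : Red (M.simple s) (M.simple s * (p⁻¹ * a)) := by
    rw [red_s_iff, s_mul_s_mul]; omega
  have h3 : wle (M.simple s) (p⁻¹ * a) := by
    have := wle_mul_iff.mpr hr2
    rwa [s_mul_s_mul] at this
  have := red_assoc' (x := p) hr2 (by rwa [s_mul_s_mul])
  refine ⟨s, this.1, ?_⟩
  have := (wle_mul_right_iff this.1 hr).mpr h3
  rwa [mul_inv_cancel_left] at this

theorem exists_join (a b : M.Group) : ∃ z, Lub wle a b z := by
  obtain ⟨z, -, hz⟩ := poset_lub (wle (M := M)) wle_refl (fun _ _ _ => wle_trans) ln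
    (fun _ _ => wle_ln) (fun _ => True) (w0 M) (by
      intro p a b hpa hpb _ _ _ _
      by_cases h1 : a = p
      · exact Or.inl h1
      by_cases h2 : b = p
      · exact Or.inr (Or.inl h2)
      obtain ⟨s, hs, hs'⟩ := exists_step hpa h1
      obtain ⟨t, ht, ht'⟩ := exists_step hpb h2
      refine Or.inr (Or.inr ⟨_, _, _, hs', ht', ?_, ?_, trivial, join_s p s t hs ht⟩)
      · unfold Red at hs; rw [hs, ln_s]; omega
      · unfold Red at ht; rw [ht, ln_s]; omega) 1 a b (one_wle a) (one_wle b) (wle_w0 a) (wle_w0 b) trivial trivial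
  exact ⟨z, hz⟩

theorem exists_head (x y : M.Group) :
    ∃ v, wle v y ∧ Red x v ∧ ∀ u, wle u y → Red x u → wle u v := by
  have hne : ∃ v, wle v y ∧ Red x v := ⟨1, one_wle y, by simp [Red, ln_one]⟩
  obtain ⟨v, hv, hmax⟩ := Set.exists_max_image {v : M.Group | wle v y ∧ Red x v} ln (Set.toFinite _) hne
  refine ⟨v, hv.1, hv.2, fun u hu hu' => ?_⟩
  obtain ⟨z, hz⟩ := exists_join u v
  have h1 : wle z y := hz.2.2 y hu hv.1
  have h2 : Red x z := by
    rw [red_iff]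
    exact hz.2.2 _ (red_iff.mp hu') (red_iff.mp hv.2)
  have := wle_eq hz.2.1 (hmax z ⟨h1, h2⟩)
  rw [this]; exact hz.1

end WeakOrder

section Matsumoto

variable {B : Type*} {M : CoxeterMatrix B}

open Classical in
/-- Product of `f` along a chosen reduced word. -/
noncomputable def matF {N : Type*} [Monoid N] (f : B → N) (w : M.Group) : N :=
  if h : w = 1 then 1 else
    f (exists_left_desc h).choose * matF f (M.simple (exists_left_desc h).choose * w)
termination_by ln w
decreasing_by exact (exists_left_desc h).choose_spec

theorem matF_one {N : Type*} [Monoid N] (f : B → N) : matF f (1 : M.Group) = 1 := by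
  rw [matF]; simp

theorem matF_s [Finite B] [Finite M.Group] {N : Type*} [Monoid N] (f : B → N)
    (hf : ∀ s t, altProd (f s) (f t) (M s t) = altProd (f t) (f s) (M s t))
    (s : B) (w : M.Group) (h : ln (M.simple s * w) = ln w + 1) :
    matF f (M.simple s * w) = f s * matF f w := by
  have main : ∀ n, ∀ w : M.Group, ln w = n → ∀ s, ln (M.simple s * w) < ln w →
      matF f w = f s * matF f (M.simple s * w) := by
    intro n
    induction n using Nat.strong_induction_on with
    | _ n ih =>
      intro w hn s hs
      have hw : w ≠ 1 := by rintro rfl; rw [ln_one] at hs; omega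
      obtain ⟨t, ht, e⟩ : ∃ t, ln (M.simple t * w) < ln w ∧
          matF f w = f t * matF f (M.simple t * w) := by
        refine ⟨(exists_left_desc hw).choose, (exists_left_desc hw).choose_spec, ?_⟩
        conv_lhs => rw [matF]
        rw [dif_neg hw]
      obtain ⟨w', hw', h1⟩ := dihedral hs ht
      have h0 := Nat.pos_of_ne_zero (M_ne_zero M s t)
      obtain ⟨m, hm⟩ : ∃ m, M s t = m + 1 := ⟨M s t - 1, by omega⟩
      have hlw : ln w = m + 1 + ln w' := by rw [hw', (h1 _ le_rfl).1, hm]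
      have sub : ∀ k ≤ m, matF f (P M s t k * w') = altProd (f s) (f t) k * matF f w' ∧
          matF f (P M t s k * w') = altProd (f t) (f s) k * matF f w' := by
        intro k
        induction k with
        | zero => simp [P_zero, altProd_zero]
        | succ k ihk =>
          intro hk
          obtain ⟨i1, i2⟩ := ihk (by omega)
          have l1 := h1 (k + 1) (by omega)
          have l0 := h1 k (by omega)
          constructor
          · have := ih (ln (P M s t (k + 1) * w')) (by omega) _ rfl s (by
              rw [P_succ, mul_assoc, s_mul_s_mul, ← mul_assoc, ← P_succ]; omega)
            rw [this, P_succ, mul_assoc, s_mul_s_mul, i2, altProd_succ, mul_assoc]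
          · have := ih (ln (P M t s (k + 1) * w')) (by omega) _ rfl t (by
              rw [P_succ, mul_assoc, s_mul_s_mul, ← mul_assoc, ← P_succ]; omega)
            rw [this, P_succ, mul_assoc, s_mul_s_mul, i1, altProd_succ, mul_assoc]
      have e1 : M.simple s * w = P M t s m * w' := by
        rw [hw', hm, P_succ, mul_assoc, s_mul_s_mul]
      have e2 : M.simple t * w = P M s t m * w' := by
        rw [hw', P_M, hm, P_succ, mul_assoc, s_mul_s_mul]
      rw [e, e1, e2, (sub m le_rfl).1, (sub m le_rfl).2, ← mul_assoc, ← mul_assoc, ← altProd_succ,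
        ← altProd_succ, ← hm, hf]
  have := main _ (M.simple s * w) rfl s (by rw [s_mul_s_mul]; omega)
  rwa [s_mul_s_mul] at this

theorem matF_mul [Finite B] [Finite M.Group] {N : Type*} [Monoid N] (f : B → N)
    (hf : ∀ s t, altProd (f s) (f t) (M s t) = altProd (f t) (f s) (M s t))
    (x y : M.Group) (h : Red x y) : matF f (x * y) = matF f x * matF f y := by
  induction x using ln_induction with
  | one => simp [matF_one]
  | step x i hi ih =>
    have := red_assoc (red_s_iff.mpr hi) h
    rw [mul_assoc, matF_s f hf i _ (red_s_iff.mp this.2), matF_s f hf i _ hi, ih this.1, mul_assoc]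

end Matsumoto

end ArtinTits


namespace ArtinTits

section MonoidBasics

variable {B : Type*} {M : CoxeterMatrix B}

/-- The braid relations in the free monoid. -/
def moRel (M : CoxeterMatrix B) (x y : FreeMonoid B) : Prop :=
  ∃ s t, x = altProd (FreeMonoid.of s) (FreeMonoid.of t) (M s t) ∧
    y = altProd (FreeMonoid.of t) (FreeMonoid.of s) (M s t)

/-- The Artin monoid. -/
abbrev Mo (M : CoxeterMatrix B) : Type _ := PresentedMonoid (moRel M)

/-- The generators of the Artin monoid. -/
def gen (M : CoxeterMatrix B) (s : B) : Mo M := PresentedMonoid.of (moRel M) s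

theorem gen_braid (s t : B) :
    altProd (gen M s) (gen M t) (M s t) = altProd (gen M t) (gen M s) (M s t) := by
  have h : PresentedMonoid.mk (moRel M) (altProd (FreeMonoid.of s) (FreeMonoid.of t) (M s t)) =
      PresentedMonoid.mk (moRel M) (altProd (FreeMonoid.of t) (FreeMonoid.of s) (M s t)) :=
    PresentedMonoid.mk_eq_mk_of_rel ⟨s, t, rfl, rfl⟩
  rw [map_altProd, map_altProd] at h
  exact h

/-- The universal property of the Artin monoid. -/
def moLift {N : Type*} [Monoid N] (f : B → N)
    (hf : ∀ s t, altProd (f s) (f t) (M s t) = altProd (f t) (f s) (M s t)) : Mo M →* N :=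
  PresentedMonoid.lift f (by
    rintro a b ⟨s, t, rfl, rfl⟩
    rw [map_altProd, map_altProd, FreeMonoid.lift_eval_of, FreeMonoid.lift_eval_of]
    exact hf s t)

theorem moLift_gen {N : Type*} [Monoid N] (f : B → N)
    (hf : ∀ s t, altProd (f s) (f t) (M s t) = altProd (f t) (f s) (M s t)) (s : B) :
    moLift f hf (gen M s) = f s := PresentedMonoid.lift_of f _

theorem mo_induction {p : Mo M → Prop} (one : p 1) (step : ∀ s m, p m → p (gen M s * m))
    (m : Mo M) : p m := by
  have hm : m ∈ Submonoid.closure (Set.range (PresentedMonoid.of (moRel M))) := by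
    rw [PresentedMonoid.closure_range_of]; trivial
  induction hm using Submonoid.closure_induction_left with
  | one => exact one
  | mul_left x hx y _ ih =>
    obtain ⟨s, rfl⟩ := hx
    exact step s y ih

theorem mo_cases (m : Mo M) : m = 1 ∨ ∃ s m', m = gen M s * m' := by
  induction m using mo_induction with
  | one => exact Or.inl rfl
  | step s m _ => exact Or.inr ⟨s, m, rfl⟩

/-- The length homomorphism. -/
def lenHom (M : CoxeterMatrix B) : Mo M →* Multiplicative ℕ :=
  moLift (fun _ => Multiplicative.ofAdd 1) (fun _ _ => rfl)

/-- The length of an element of the Artin monoid. -/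
def len (m : Mo M) : ℕ := Multiplicative.toAdd (lenHom M m)

theorem len_one : len (1 : Mo M) = 0 := by simp [len]

theorem len_mul (a b : Mo M) : len (a * b) = len a + len b := by simp [len]

theorem len_gen (s : B) : len (gen M s) = 1 := by simp [len, lenHom, moLift_gen]

theorem len_eq_zero {m : Mo M} (h : len m = 0) : m = 1 := by
  rcases mo_cases m with h1 | ⟨s, m', rfl⟩
  · exact h1
  · rw [len_mul, len_gen] at h; omega

theorem len_eq_one {m : Mo M} (h : len m = 1) : ∃ s, m = gen M s := by
  rcases mo_cases m with rfl | ⟨s, m', rfl⟩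
  · rw [len_one] at h; omega
  · rw [len_mul, len_gen] at h
    exact ⟨s, by rw [len_eq_zero (m := m') (by omega), mul_one]⟩

theorem len_dvd {a b : Mo M} (h : a ∣ b) : len a ≤ len b := by
  obtain ⟨c, rfl⟩ := h
  rw [len_mul]; omega

theorem dvd_len_eq {a b : Mo M} (h : a ∣ b) (h' : len b ≤ len a) : a = b := by
  obtain ⟨c, rfl⟩ := h
  rw [len_mul] at h'
  rw [len_eq_zero (m := c) (by omega), mul_one]

/-- The projection to the Coxeter group. -/
def prj : Mo M →* M.Group := moLift M.simple P_M

theorem prj_gen (s : B) : prj (gen M s) = M.simple s := moLift_gen _ _ s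

theorem ln_prj_le (m : Mo M) : ln (prj m) ≤ len m := by
  induction m using mo_induction with
  | one => simp [ln_one]
  | step s m ih =>
    rw [map_mul, len_mul, len_gen, prj_gen]
    have := ln_mul_le (M.simple s) (prj m)
    rw [ln_s] at this; omega

theorem altProd_idem {N : Type*} [CommMonoid N] (a b : N) (ha : a * a = a) (hb : b * b = b) (n : ℕ) :
    altProd a b (n + 2) = a * b := by
  induction n generalizing a b with
  | zero => simp [altProd]
  | succ n ih => rw [altProd_succ, ih b a hb ha, mul_comm b a, ← mul_assoc, ha]

open Classical in
/-- The homomorphism detecting the support. -/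
noncomputable def chi (M : CoxeterMatrix B) : Mo M →* (B → ℕ) :=
  moLift (fun s b => if b = s then 0 else 1) (by
    intro s t
    rcases eq_or_ne s t with rfl | hst
    · rfl
    · have h1 := M.off_diagonal s t hst
      obtain h0 | h2 : M s t = 0 ∨ 2 ≤ M s t := by omega
      · rw [h0]; rfl
      · obtain ⟨n, hn⟩ := Nat.exists_eq_add_of_le' h2
        have idem : ∀ s : B, (fun b => if b = s then 0 else 1 : B → ℕ) * (fun b => if b = s then 0 else 1) =
            (fun b => if b = s then 0 else 1) := by
          intro s; ext b; simp
        rw [hn, altProd_idem _ _ (idem s) (idem t), altProd_idem _ _ (idem t) (idem s), mul_comm])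

/-- The support of an element of the Artin monoid. -/
def supp (m : Mo M) : Set B := {b | chi M m b = 0}

theorem supp_one : supp (1 : Mo M) = ∅ := by ext b; simp [supp]

theorem supp_mul (a b : Mo M) : supp (a * b) = supp a ∪ supp b := by
  ext c; simp [supp]

theorem supp_gen (s : B) : supp (gen M s) = {s} := by
  ext c; simp [supp, chi, moLift_gen]

theorem supp_altProd (s t : B) (k : ℕ) : supp (altProd (gen M s) (gen M t) k) ⊆ {s, t} := by
  induction k generalizing s t with
  | zero => simp [altProd_zero, supp_one]
  | succ k ih =>
    rw [altProd_succ, supp_mul, supp_gen]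
    apply Set.union_subset (by simp)
    rw [Set.pair_comm]; exact ih t s

theorem supp_dvd {a b : Mo M} (h : a ∣ b) : supp a ⊆ supp b := by
  obtain ⟨c, rfl⟩ := h
  rw [supp_mul]; exact Set.subset_union_left

end MonoidBasics

section Garside

variable {B : Type*} {M : CoxeterMatrix B} [Finite B] [Finite M.Group]

/-- The canonical section of the Coxeter group in the Artin monoid. -/
noncomputable def L (w : M.Group) : Mo M := matF (gen M) w

theorem L_one : L (1 : M.Group) = 1 := matF_one _

theorem L_mul {x y : M.Group} (h : Red x y) : L (x * y) = L x * L y :=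
  matF_mul _ gen_braid x y h

theorem L_s (s : B) : L (M.simple s) = gen M s := by
  have := matF_s (M := M) (gen M) gen_braid s 1 (by simp [ln_one, ln_s])
  rwa [mul_one, matF_one, mul_one] at this

theorem L_s_mul {s : B} {w : M.Group} (h : ln (M.simple s * w) = ln w + 1) :
    L (M.simple s * w) = gen M s * L w := by
  rw [L_mul (red_s_iff.mpr h), L_s]

theorem prj_L (w : M.Group) : prj (L w) = w := by
  induction w using ln_induction with
  | one => rw [L_one, map_one]
  | step w i h ih => rw [L_s_mul h, map_mul, prj_gen, ih]

theorem len_L (w : M.Group) : len (L w) = ln w := by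
  induction w using ln_induction with
  | one => rw [L_one, len_one, ln_one]
  | step w i h ih => rw [L_s_mul h, len_mul, len_gen, ih, h]; omega

theorem eq_L {m : Mo M} (h : len m ≤ ln (prj m)) : m = L (prj m) := by
  induction m using mo_induction with
  | one => rw [map_one, L_one]
  | step s m ih =>
    rw [map_mul, len_mul, len_gen, prj_gen] at h
    have h1 := ln_mul_le (M.simple s) (prj m)
    have h2 := ln_prj_le m
    rw [ln_s] at h1
    rw [map_mul, prj_gen, L_s_mul (by omega), ← ih (by omega)]

theorem factor_L {a b : Mo M} {w : M.Group} (h : L w = a * b) :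
    a = L (prj a) ∧ b = L (prj b) ∧ Red (prj a) (prj b) ∧ w = prj a * prj b := by
  have h1 := congrArg prj h
  have h2 := congrArg len h
  rw [prj_L, map_mul] at h1
  rw [len_L, len_mul, h1] at h2
  have h3 := ln_mul_le (prj a) (prj b)
  have h4 := ln_prj_le a
  have h5 := ln_prj_le b
  exact ⟨eq_L (by omega), eq_L (by omega), by unfold Red; omega, h1⟩

theorem L_P (s t : B) (k : ℕ) (hk : k ≤ M s t) : L (P M s t k) = altProd (gen M s) (gen M t) k := by
  induction k generalizing s t with
  | zero => rw [P_zero, L_one]; rfl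
  | succ k ih =>
    have h2 : k ≤ M t s := by rw [M.symmetric]; omega
    rw [P_succ, L_s_mul, ih t s h2, altProd_succ]
    rw [← P_succ, ln_P _ _ _ hk, ln_P _ _ _ h2]

/-- The maximal head. -/
noncomputable def hd (x y : M.Group) : M.Group := (exists_head x y).choose

theorem hd_wle (x y : M.Group) : wle (hd x y) y := (exists_head x y).choose_spec.1

theorem hd_red (x y : M.Group) : Red x (hd x y) := (exists_head x y).choose_spec.2.1

theorem hd_max {x y u : M.Group} (h1 : wle u y) (h2 : Red x u) : wle u (hd x y) :=
  (exists_head x y).choose_spec.2.2 u h1 h2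

theorem red_of_wle {a b c : M.Group} (h1 : wle a b) (h2 : wle b c) : Red (a⁻¹ * b) (b⁻¹ * c) := by
  have h3 := wle_trans h1 h2
  unfold wle at *
  unfold Red
  rw [show a⁻¹ * b * (b⁻¹ * c) = a⁻¹ * c by group]
  omega

theorem wle_antisymm {x y : M.Group} (h1 : wle x y) (h2 : wle y x) : x = y :=
  wle_eq h1 (wle_ln h2)

theorem L_wle {x y : M.Group} (h : wle x y) : L y = L x * L (x⁻¹ * y) := by
  rw [← L_mul, mul_inv_cancel_left]
  rw [← wle_mul_iff, mul_inv_cancel_left]; exact h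

/-- The action of simple elements on normal forms. -/
noncomputable def T (x : M.Group) : Function.End (M.Group × Mo M) :=
  fun p => (x * hd x p.1, L ((hd x p.1)⁻¹ * p.1) * p.2)

theorem T_apply (x : M.Group) (y : M.Group) (n : Mo M) :
    T x (y, n) = (x * hd x y, L ((hd x y)⁻¹ * y) * n) := rfl

theorem T_one : T (1 : M.Group) = 1 := by
  funext ⟨y, n⟩
  have : hd 1 y = y := wle_antisymm (hd_wle _ _) (hd_max (wle_refl y) (by simp [Red, ln_one]))
  rw [T_apply, this, inv_mul_cancel, L_one, one_mul, one_mul]; rfl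

theorem T_mul {x x' : M.Group} (h : Red x x') : T x * T x' = T (x * x') := by
  funext ⟨y, n⟩
  rw [end_mul, T_apply, T_apply, T_apply]
  have hv' := hd_red x' y
  have key : hd x (x' * hd x' y) = x' * hd (x * x') y := by
    apply wle_antisymm
    · have h1 : wle x' (hd x (x' * hd x' y)) := hd_max (wle_mul_iff.mpr hv') h
      set v := hd x (x' * hd x' y) with hv
      have h2 : v = x' * (x'⁻¹ * v) := by simp
      have h3 : Red x' (x'⁻¹ * v) := by rw [← wle_mul_iff, ← h2]; exact h1
      have h4 : wle v (x' * hd x' y) := hd_wle _ _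
      have h4' : wle (x'⁻¹ * v) (hd x' y) := by
        rw [h2, wle_mul_right_iff h3 hv'] at h4; exact h4
      have h5 : Red x v := hd_red _ _
      have h6 := red_assoc' (x := x) h3 (by rw [← h2]; exact h5)
      have h7 := hd_max (wle_trans h4' (hd_wle _ _)) h6.2
      rw [h2, wle_mul_right_iff h3 (red_assoc h (hd_red _ _)).1]
      exact h7
    · have h1 := red_assoc h (hd_red (x * x') y)
      apply hd_max _ h1.2
      rw [wle_mul_right_iff h1.1 hv']
      exact hd_max (hd_wle _ _) h1.1
  have h1 := red_assoc h (hd_red (x * x') y)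
  have h2 : wle (hd (x * x') y) (hd x' y) := hd_max (hd_wle _ _) h1.1
  refine Prod.ext ?_ ?_
  · simp only [key, mul_assoc]
  · simp only [key]
    rw [show (x' * hd (x * x') y)⁻¹ * (x' * hd x' y) = (hd (x * x') y)⁻¹ * hd x' y by group,
      ← mul_assoc, ← L_mul (red_of_wle h2 (hd_wle _ _))]
    congr 2
    group

theorem T_altProd (s t : B) (k : ℕ) (hk : k ≤ M s t) :
    altProd (T (M.simple s)) (T (M.simple t)) k = T (P M s t k) := by
  induction k generalizing s t with
  | zero => rw [altProd_zero, P_zero, T_one]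
  | succ k ih =>
    have h2 : k ≤ M t s := by rw [M.symmetric]; omega
    rw [altProd_succ, ih t s h2, T_mul, ← P_succ]
    rw [red_s_iff, ← P_succ, ln_P _ _ _ hk, ln_P _ _ _ h2]

/-- The action of the Artin monoid on normal forms. -/
noncomputable def act : Mo M →* Function.End (M.Group × Mo M) :=
  moLift (fun s => T (M.simple s)) (fun s t => by
    rw [T_altProd s t _ le_rfl, T_altProd t s _ (by rw [M.symmetric]), P_M])

theorem act_gen (s : B) : act (gen M s) = T (M.simple s) := moLift_gen _ _ s

theorem act_L (x : M.Group) : act (L x) = T x := by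
  induction x using ln_induction with
  | one => rw [L_one, map_one, T_one]
  | step x i h ih => rw [L_s_mul h, map_mul, act_gen, ih, T_mul (red_s_iff.mpr h)]

theorem act_val (m : Mo M) (p : M.Group × Mo M) : L (act m p).1 * (act m p).2 = m * (L p.1 * p.2) := by
  induction m using mo_induction with
  | one => rw [map_one, one_mul]; rfl
  | step s m ih =>
    rw [map_mul, end_mul, act_gen, mul_assoc, ← ih]
    generalize act m p = q
    obtain ⟨y, n⟩ := q
    rw [T_apply]
    simp only
    rw [L_mul (hd_red _ _), L_s, L_wle (hd_wle (M.simple s) y)]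
    simp [mul_assoc]

theorem act_cancel (s : B) (m : Mo M) :
    m = L (M.simple s * (act (gen M s * m) (1, 1)).1) * (act (gen M s * m) (1, 1)).2 := by
  rw [map_mul, end_mul, act_gen]
  have := act_val m (1, 1)
  generalize act m (1, 1) = q at this
  obtain ⟨y, n⟩ := q
  rw [T_apply]
  simp only at this ⊢
  rw [s_mul_s_mul, ← mul_assoc, ← L_wle (hd_wle (M.simple s) y), this, L_one]
  simp

theorem mo_cancel {a b c : Mo M} (h : a * b = a * c) : b = c := by
  induction a using mo_induction with
  | one => simpa using h
  | step s m ih =>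
    apply ih
    rw [mul_assoc, mul_assoc] at h
    rw [act_cancel s (m * b), act_cancel s (m * c), h]

instance : IsLeftCancelMul (Mo M) := ⟨fun _ _ _ h => mo_cancel h⟩

theorem L_dvd_iff {x : M.Group} {m : Mo M} : L x ∣ m ↔ wle x (act m (1, 1)).1 := by
  constructor
  · rintro ⟨k, rfl⟩
    rw [map_mul, end_mul, act_L]
    exact wle_mul_iff.mpr (hd_red _ _)
  · intro h
    have := act_val m (1, 1)
    rw [L_one, one_mul, mul_one] at this
    rw [← this]
    exact Dvd.dvd.mul_right ⟨_, L_wle h⟩ _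

theorem lcm_gen {s t : B} {m : Mo M} (hs : gen M s ∣ m) (ht : gen M t ∣ m) :
    altProd (gen M s) (gen M t) (M s t) ∣ m := by
  rw [← L_s, L_dvd_iff] at hs ht
  rw [← L_P _ _ _ le_rfl, L_dvd_iff]
  have := (join_s (M := M) 1 s t (by simp [Red, ln_one]) (by simp [Red, ln_one])).2.2
    (act m (1, 1)).1 (by simpa using hs) (by simpa using ht)
  simpa using this

theorem gen_dvd_altProd (s t : B) : gen M s ∣ altProd (gen M s) (gen M t) (M s t) := by
  have h0 := Nat.pos_of_ne_zero (M_ne_zero M s t)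
  obtain ⟨k, hk⟩ : ∃ k, M s t = k + 1 := ⟨M s t - 1, by omega⟩
  rw [hk, altProd_succ]; exact Dvd.intro _ rfl

theorem dvd_cancel {a b c : Mo M} (h : a * b ∣ a * c) : b ∣ c := by
  obtain ⟨d, hd⟩ := h
  rw [mul_assoc] at hd
  exact ⟨d, mo_cancel hd⟩

theorem lub_gen (p : Mo M) (s t : B) : Lub (· ∣ ·) (p * gen M s) (p * gen M t)
    (p * altProd (gen M s) (gen M t) (M s t)) := by
  refine ⟨mul_dvd_mul_left _ (gen_dvd_altProd s t), mul_dvd_mul_left _ ?_, ?_⟩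
  · rw [gen_braid, M.symmetric]; exact gen_dvd_altProd t s
  · intro c h1 h2
    obtain ⟨d, rfl⟩ := (Dvd.intro _ rfl : p ∣ p * gen M s).trans h1
    exact mul_dvd_mul_left _ (lcm_gen (dvd_cancel h1) (dvd_cancel h2))

theorem mo_lub {a b m : Mo M} (Y : Set B) (ha : a ∣ m) (hb : b ∣ m) (haY : supp a ⊆ Y)
    (hbY : supp b ⊆ Y) : ∃ z, supp z ⊆ Y ∧ Lub (· ∣ ·) a b z := by
  refine poset_lub (Q := Mo M) (· ∣ ·) dvd_refl (fun _ _ _ => dvd_trans) len (fun _ _ => len_dvd)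
    (fun z => supp z ⊆ Y) m ?_ 1 a b (one_dvd _) (one_dvd _) ha hb haY hbY
  rintro p a b ⟨x, rfl⟩ ⟨y, rfl⟩ - - h1 h2
  rw [supp_mul, Set.union_subset_iff] at h1 h2
  rcases mo_cases x with rfl | ⟨s, x', rfl⟩
  · exact Or.inl (mul_one _)
  rcases mo_cases y with rfl | ⟨t, y', rfl⟩
  · exact Or.inr (Or.inl (mul_one _))
  refine Or.inr (Or.inr ⟨_, _, _, mul_dvd_mul_left _ (Dvd.intro _ rfl),
    mul_dvd_mul_left _ (Dvd.intro _ rfl), ?_, ?_, ?_, lub_gen p s t⟩)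
  · rw [len_mul, len_gen]; omega
  · rw [len_mul, len_gen]; omega
  · rw [supp_mul]
    refine Set.union_subset h1.1 ((supp_altProd s t _).trans ?_)
    have h3 := h1.2
    have h4 := h2.2
    rw [supp_mul, supp_gen, Set.union_subset_iff] at h3 h4
    exact Set.insert_subset (by simpa using h3.1) h4.1

end Garside

end ArtinTits


namespace ArtinTits

section GarsideElement

variable {B : Type*} {M : CoxeterMatrix B} [Finite B]

theorem finite_len (M : CoxeterMatrix B) (n : ℕ) : {m : Mo M | len m ≤ n}.Finite := by
  induction n with
  | zero =>
    refine (Set.finite_singleton (1 : Mo M)).subset ?_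
    intro m hm
    exact len_eq_zero (Nat.le_zero.mp hm)
  | succ n ih =>
    refine ((Set.finite_singleton (1 : Mo M)).union
      (Set.Finite.image2 (fun (s : B) m => gen M s * m) Set.finite_univ ih)).subset ?_
    intro m hm
    rcases mo_cases m with rfl | ⟨s, m', rfl⟩
    · exact Or.inl rfl
    · refine Or.inr ⟨s, Set.mem_univ _, m', ?_, rfl⟩
      have : len (gen M s * m') ≤ n + 1 := hm
      rw [len_mul, len_gen] at this
      show len m' ≤ n
      omega

theorem exists_max_len {p : Mo M → Prop} (n : ℕ) (hp : ∃ a, p a) (hn : ∀ a, p a → len a ≤ n) :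
    ∃ a, p a ∧ ∀ b, p b → len b ≤ len a := by
  obtain ⟨a, ha, h⟩ := Set.exists_max_image {a | p a} len ((finite_len M n).subset hn) hp
  exact ⟨a, ha, h⟩

variable [Finite M.Group]

/-- A common multiple-closed family has a greatest element. -/
theorem exists_gcd (Y : Set B) {g d : Mo M} :
    ∃ v, (supp v ⊆ Y ∧ v ∣ g ∧ v ∣ d) ∧ ∀ f, supp f ⊆ Y → f ∣ g → f ∣ d → f ∣ v := by
  obtain ⟨v, ⟨h1, h2, h3⟩, hv⟩ := exists_max_len (p := fun v : Mo M => supp v ⊆ Y ∧ v ∣ g ∧ v ∣ d)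
    (len g) ⟨1, by simp [supp_one], one_dvd _, one_dvd _⟩ (fun a ha => len_dvd ha.2.1)
  refine ⟨v, ⟨h1, h2, h3⟩, fun f hf1 hf2 hf3 => ?_⟩
  obtain ⟨z, hz, hz1, hz2, hz3⟩ := mo_lub Y h2 hf2 h1 hf1
  have := dvd_len_eq hz1 (hv z ⟨hz, hz3 _ h2 hf2, hz3 _ h3 hf3⟩)
  rw [this]; exact hz2

/-- The Garside element. -/
noncomputable def Dl (M : CoxeterMatrix B) [Finite M.Group] : Mo M := L (w0 M)

theorem L_dvd_Dl (w : M.Group) : L w ∣ Dl M := ⟨_, L_wle (wle_w0 w)⟩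

theorem gen_dvd_Dl (s : B) : gen M s ∣ Dl M := by rw [← L_s]; exact L_dvd_Dl _

theorem factor_Dl {a b : Mo M} (h : Dl M = a * b) : a ∣ Dl M ∧ b ∣ Dl M := by
  refine ⟨⟨b, h⟩, ?_⟩
  rw [(factor_L h).2.1]; exact L_dvd_Dl _

theorem simple_of_dvd {a : Mo M} (h : a ∣ Dl M) : a = L (prj a) := by
  obtain ⟨b, h⟩ := h
  exact (factor_L h).1

theorem gen_mul_Dl (s : B) : ∃ t, gen M s * Dl M = Dl M * gen M t ∧
    w0 M * M.simple s * w0 M = M.simple t := by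
  obtain ⟨t, ht⟩ := w0_conj (M := M) s
  refine ⟨t, ?_, ht⟩
  have e : M.simple s * w0 M = w0 M * M.simple t := by
    rw [← ht]; simp only [← mul_assoc, w0_mul_w0, one_mul]
  have h1 := ln_mul_w0 (M.simple s)
  rw [ln_s] at h1
  have h2 : Dl M = gen M s * L (M.simple s * w0 M) := by
    rw [← L_s_mul, s_mul_s_mul]; rfl
    rw [s_mul_s_mul]; omega
  have h3 : Dl M = L (M.simple s * w0 M) * gen M t := by
    rw [← L_s, ← L_mul, e, mul_s_mul_s]; rfl
    unfold Red
    rw [e, mul_s_mul_s, ln_s, ← e]; omega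
  calc gen M s * Dl M = gen M s * (L (M.simple s * w0 M) * gen M t) := by rw [← h3]
    _ = _ := by rw [← mul_assoc, ← h2]

/-- The central element. -/
noncomputable def de (M : CoxeterMatrix B) [Finite M.Group] : Mo M := Dl M * Dl M

theorem de_central (m : Mo M) : m * de M = de M * m := by
  induction m using mo_induction with
  | one => simp
  | step s m ih =>
    obtain ⟨t, ht, et⟩ := gen_mul_Dl (M := M) s
    obtain ⟨u, hu, eu⟩ := gen_mul_Dl (M := M) t
    have : M.simple u = M.simple s := by
      rw [← eu, ← et]
      calc w0 M * (w0 M * M.simple s * w0 M) * w0 M = (w0 M * w0 M) * M.simple s * (w0 M * w0 M) := by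
            simp only [mul_assoc]
        _ = _ := by rw [w0_mul_w0]; simp
    rw [simple_inj M this] at hu
    rw [mul_assoc, ih, ← mul_assoc, ← mul_assoc]
    congr 1
    unfold de
    rw [← mul_assoc, ht, mul_assoc, hu, mul_assoc]

theorem de_pow_central (m : Mo M) (k : ℕ) : m * de M ^ k = de M ^ k * m := by
  induction k with
  | zero => simp
  | succ k ih => rw [pow_succ, ← mul_assoc, ih, mul_assoc, de_central, mul_assoc]

theorem exists_compl (m : Mo M) : ∃ m' k, m * m' = de M ^ k ∧ m' * m = de M ^ k := by
  have : ∃ m' k, m * m' = de M ^ k := by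
    induction m using mo_induction with
    | one => exact ⟨1, 0, by simp⟩
    | step s m ih =>
      obtain ⟨m', k, h⟩ := ih
      obtain ⟨u, hu⟩ := gen_dvd_Dl (M := M) s
      refine ⟨m' * u * Dl M, k + 1, ?_⟩
      calc gen M s * m * (m' * u * Dl M) = gen M s * (m * m') * u * Dl M := by simp only [mul_assoc]
        _ = de M ^ k * (gen M s * u) * Dl M := by rw [h, de_pow_central]; simp only [mul_assoc]
        _ = _ := by rw [← hu, pow_succ, mul_assoc]; rfl
  obtain ⟨m', k, h⟩ := this
  refine ⟨m', k, h, ?_⟩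
  apply mo_cancel (a := m)
  rw [← mul_assoc, h, de_pow_central]

theorem mo_cancel_right {a b c : Mo M} (h : a * c = b * c) : a = b := by
  obtain ⟨c', k, h1, -⟩ := exists_compl c
  have : a * de M ^ k = b * de M ^ k := by rw [← h1, ← mul_assoc, h, mul_assoc]
  rw [de_pow_central, de_pow_central] at this
  exact mo_cancel this

instance : IsRightCancelMul (Mo M) := ⟨fun _ _ _ h => mo_cancel_right h⟩

theorem gen_inj {s t : B} (h : gen M s = gen M t) : s = t := by
  have := congrArg prj h
  rw [prj_gen, prj_gen] at this
  exact simple_inj M this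

theorem gen_mul_L {y : B} {w : M.Group} (h : ¬ gen M y ∣ L w) : ln (M.simple y * w) = ln w + 1 := by
  rcases ln_s_mul w y with h1 | h1
  · exact h1
  · exfalso
    apply h
    refine ⟨L (M.simple y * w), ?_⟩
    rw [← L_s_mul, s_mul_s_mul]
    rw [s_mul_s_mul]; omega

/-- The complement of the parabolic Garside element. -/
theorem exists_d (M : CoxeterMatrix B) [Finite M.Group] (Y : Set B) :
    ∃ d : Mo M, d ∣ Dl M ∧ (∀ y ∈ Y, ¬ gen M y ∣ d) ∧ (∀ s, s ∉ Y → gen M s ∣ d) ∧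
      ∀ y ∈ Y, d ∣ gen M y * d := by
  obtain ⟨E, ⟨hE, ⟨d, hd⟩, -⟩, hmax⟩ := exists_gcd Y (g := Dl M) (d := Dl M)
  obtain ⟨eE, ed, hred, -⟩ := factor_L hd
  refine ⟨d, (factor_Dl hd).2, ?_, ?_, ?_⟩
  · rintro y hy ⟨d', rfl⟩
    have hdv : E * gen M y ∣ Dl M := ⟨d', by rw [hd, mul_assoc]⟩
    have := len_dvd (hmax (E * gen M y) (by
      rw [supp_mul, supp_gen]; exact Set.union_subset hE (by simpa using hy)) hdv hdv)
    rw [len_mul, len_gen] at this; omega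
  · intro s hs
    rcases ln_mul_s (prj E) s with h | h
    · have : E * gen M s ∣ Dl M := by
        rw [eE, ← L_s, ← L_mul (by unfold Red; rw [ln_s]; exact h)]; exact L_dvd_Dl _
      rw [hd] at this
      exact dvd_cancel this
    · exfalso
      apply hs
      apply hE
      rw [eE]
      have : L (prj E) = L (prj E * M.simple s) * gen M s := by
        rw [← L_s, ← L_mul, mul_s_mul_s]
        unfold Red
        rw [mul_s_mul_s, ln_s]; omega
      rw [this, supp_mul, supp_gen]
      exact Or.inr rfl
  · have hy : ∀ y ∈ Y, ∃ y' ∈ Y, gen M y * E = E * gen M y' := by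
      intro y hy
      obtain ⟨r, hr⟩ := hmax (gen M y) (by rw [supp_gen]; simpa using hy) (gen_dvd_Dl y) (gen_dvd_Dl y)
      have hr1 : r ∣ Dl M := by
        rw [hr] at eE
        rw [(factor_L eE.symm).2.1]; exact L_dvd_Dl _
      have hr2 : supp r ⊆ Y := by
        rw [hr, supp_mul] at hE; exact Set.subset_union_right.trans hE
      obtain ⟨t, ht⟩ := hmax r hr2 hr1 hr1
      have e : len (gen M y * r) = len (r * t) := by rw [← hr, ← ht]
      rw [len_mul, len_mul, len_gen] at e
      obtain ⟨y', rfl⟩ := len_eq_one (m := t) (by omega)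
      refine ⟨y', ?_, ?_⟩
      · apply hE; rw [ht, supp_mul, supp_gen]; exact Or.inr rfl
      · calc gen M y * E = gen M y * (r * gen M y') := by rw [← ht]
          _ = _ := by rw [← mul_assoc, ← hr]
    choose! f hf hf' using hy
    have hinj : Set.InjOn f Y := by
      intro a ha b hb hab
      have h1 := hf' a ha
      rw [hab, ← hf' b hb] at h1
      exact gen_inj (mo_cancel_right h1)
    have hsurj : Set.SurjOn f Y Y := ((Set.Finite.injOn_iff_bijOn_of_mapsTo (Set.toFinite Y) hf).mp hinj).surjOn
    intro y hy
    obtain ⟨y'', hy'', rfl⟩ := hsurj hy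
    obtain ⟨t, ht, -⟩ := gen_mul_Dl (M := M) y''
    refine ⟨gen M t, ?_⟩
    apply mo_cancel (a := E)
    rw [← mul_assoc, ← hf' _ hy'', mul_assoc, ← hd, ht, ← mul_assoc, ← hd]

theorem mo_exchange {y b : B} {p p1 : Mo M} (hp : p ∣ Dl M) (hy : ¬ gen M y ∣ p)
    (hl : Lub (· ∣ ·) (gen M y) p (gen M y * p1)) (h : gen M y * p1 = p * gen M b) : p1 = p := by
  have h1 : gen M y * p1 ∣ Dl M := hl.2.2 _ (gen_dvd_Dl y) hp
  have ep := simple_of_dvd hp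
  have e1 := simple_of_dvd h1
  have f1 := factor_L e1.symm
  have f2 := factor_L (e1.symm.trans h)
  rw [prj_gen] at f1 f2
  have k1 : ln (M.simple y * prj p) = ln (prj p) + 1 := gen_mul_L (by rwa [← ep])
  have k2 := f1.2.2.1
  have e2 : M.simple y * prj p1 = prj p * M.simple b := by rw [← f1.2.2.2, ← f2.2.2.2]
  have k3 := exchange k1 (b := b) (by
    rw [← e2, s_mul_s_mul, k2, ln_s]; omega)
  rw [← e2] at k3
  rw [f1.2.1, ep, mul_left_cancel k3]

end GarsideElement

end ArtinTits


namespace ArtinTits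

section PartTwo

variable {B : Type*} {M : CoxeterMatrix B} [Finite B] [Finite M.Group]

theorem chain_lemma {Y : Set B} {d : Mo M} (hd : d ∣ Dl M) (hd1 : ∀ y ∈ Y, ¬ gen M y ∣ d)
    (hd2 : ∀ y ∈ Y, d ∣ gen M y * d) (a : Mo M) :
    ∀ p q : Mo M, supp a ⊆ Y → p ∣ d → Lub (· ∣ ·) a p (a * q) →
      q ∣ d ∧ len p ≤ len q ∧ (len q ≤ len p → q = p ∧
        ∀ y ∈ supp a, ∃ b, gen M y * p = p * gen M b) := by
  induction a using mo_induction with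
  | one =>
    intro p q _ hp hl
    rw [one_mul] at hl
    have h1 : q ∣ p := hl.2.2 _ (one_dvd _) dvd_rfl
    have h2 : q = p := dvd_len_eq h1 (len_dvd hl.2.1)
    subst h2
    refine ⟨hp, le_rfl, fun _ => ⟨rfl, fun y hy => ?_⟩⟩
    rw [supp_one] at hy
    exact hy.elim
  | step y a ih =>
    intro p q hs hp hl
    rw [supp_mul, supp_gen, Set.union_subset_iff, Set.singleton_subset_iff] at hs
    obtain ⟨hy, hs⟩ := hs
    obtain ⟨z, -, hz⟩ := mo_lub Set.univ (Dvd.intro _ rfl : gen M y ∣ gen M y * d)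
      (hp.trans (hd2 y hy)) (Set.subset_univ _) (Set.subset_univ _)
    obtain ⟨p1, rfl⟩ := hz.1
    have hp1 : p1 ∣ d := dvd_cancel (hz.2.2 _ (Dvd.intro _ rfl) (hp.trans (hd2 y hy)))
    have hyp : ¬ gen M y ∣ p := fun h => hd1 y hy (h.trans hp)
    have hl' : Lub (· ∣ ·) a p1 (a * q) := by
      refine ⟨Dvd.intro _ rfl, ?_, ?_⟩
      · have := hz.2.2 (gen M y * a * q) (by rw [mul_assoc]; exact Dvd.intro _ rfl) hl.2.1
        rw [mul_assoc] at this
        exact dvd_cancel this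
      · intro c h1 h2
        have := hl.2.2 (gen M y * c) (mul_dvd_mul_left _ h1)
          (hz.2.1.trans (mul_dvd_mul_left _ h2))
        rw [mul_assoc] at this
        exact dvd_cancel this
    obtain ⟨i1, i2, i3⟩ := ih p1 q hs hp1 hl'
    obtain ⟨t, ht⟩ := hz.2.1
    have ht1 : len t ≠ 0 := by
      intro h
      rw [len_eq_zero h, mul_one] at ht
      exact hyp ⟨_, ht.symm⟩
    have hlen : 1 + len p1 = len p + len t := by
      rw [← len_mul, ← ht, len_mul, len_gen]
    refine ⟨i1, by omega, fun hq => ?_⟩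
    obtain ⟨b, rfl⟩ := len_eq_one (m := t) (by omega)
    have e := mo_exchange (hp.trans hd) hyp hz ht
    subst e
    obtain ⟨j1, j2⟩ := i3 (by omega)
    refine ⟨j1, ?_⟩
    rw [supp_mul, supp_gen]
    rintro y' (rfl | hy')
    · exact ⟨b, ht⟩
    · exact j2 y' hy'

theorem push_right {Y : Set B} {v : Mo M} {φ : B → B} (h : ∀ y ∈ Y, gen M y * v = v * gen M (φ y))
    (m : Mo M) : supp m ⊆ Y → ∃ m', m * v = v * m' ∧ supp m' = φ '' supp m := by
  induction m using mo_induction with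
  | one => exact fun _ => ⟨1, by simp, by simp [supp_one]⟩
  | step y m ih =>
    intro hs
    rw [supp_mul, supp_gen, Set.union_subset_iff, Set.singleton_subset_iff] at hs
    obtain ⟨m', h1, h2⟩ := ih hs.2
    refine ⟨gen M (φ y) * m', ?_, ?_⟩
    · rw [mul_assoc, h1, ← mul_assoc, h y hs.1, mul_assoc]
    · rw [supp_mul, supp_mul, supp_gen, supp_gen, h2, Set.image_union, Set.image_singleton]

theorem push_left {Y : Set B} {v : Mo M} {φ : B → B} (h : ∀ y ∈ Y, gen M y * v = v * gen M (φ y))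
    (m : Mo M) : supp m ⊆ φ '' Y → ∃ m', v * m = m' * v ∧ supp m' ⊆ Y := by
  induction m using mo_induction with
  | one => exact fun _ => ⟨1, by simp, by simp [supp_one]⟩
  | step y m ih =>
    intro hs
    rw [supp_mul, supp_gen, Set.union_subset_iff, Set.singleton_subset_iff] at hs
    obtain ⟨⟨y, hy, rfl⟩, hs⟩ := hs
    obtain ⟨m', h1, h2⟩ := ih hs
    refine ⟨gen M y * m', ?_, ?_⟩
    · rw [← mul_assoc, ← h y hy, mul_assoc, h1, mul_assoc]
    · rw [supp_mul, supp_gen]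
      exact Set.union_subset (by simpa using hy) h2

theorem part_two (n : ℕ) : ∀ g : Mo M, len g ≤ n → ∀ α β : Mo M, α * g = g * β →
    (supp β).ncard ≤ (supp α).ncard ∧ ((supp α).ncard ≤ (supp β).ncard →
      ∃ u ρ, supp u ⊆ supp α ∧ g = u * ρ ∧
        (∀ y ∈ supp α, ∃ b ∈ supp β, gen M y * ρ = ρ * gen M b) ∧
        (∀ b ∈ supp β, ∃ y ∈ supp α, gen M y * ρ = ρ * gen M b)) := by
  induction n with
  | zero =>
    intro g hg α β h
    have := len_eq_zero (Nat.le_zero.mp hg)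
    subst this
    rw [mul_one, one_mul] at h
    subst h
    exact ⟨le_rfl, fun _ => ⟨1, 1, by simp [supp_one], by simp, fun y hy => ⟨y, hy, by simp⟩,
      fun y hy => ⟨y, hy, by simp⟩⟩⟩
  | succ n ih =>
    intro g hg α β h
    by_cases hA : ∃ y ∈ supp α, gen M y ∣ g
    · obtain ⟨y, hy, hyg⟩ := hA
      obtain ⟨v, ⟨v1, ⟨g', v2⟩, -⟩, v4⟩ := exists_gcd (supp α) (g := g) (d := g)
      have hvg : v ∣ g := ⟨g', v2⟩
      obtain ⟨c, hc, c1, c2, c3⟩ := mo_lub (supp α) (Dvd.intro _ rfl : α ∣ α * g)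
        (hvg.trans (by rw [h]; exact Dvd.intro _ rfl)) subset_rfl v1
      obtain ⟨f, rfl⟩ := c1
      have hfg : f ∣ g := dvd_cancel (c3 (α * g) (Dvd.intro _ rfl)
        (hvg.trans (by rw [h]; exact Dvd.intro _ rfl)))
      have hfs : supp f ⊆ supp α := by
        rw [supp_mul] at hc; exact Set.subset_union_right.trans hc
      have hfv := v4 f hfs hfg hfg
      obtain ⟨α', hα'⟩ := c2.trans (mul_dvd_mul_left α hfv)
      have hs' : supp α' ⊆ supp α := by
        have := congrArg supp hα'
        rw [supp_mul, supp_mul, Set.union_eq_self_of_subset_right v1] at this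
        rw [this]; exact Set.subset_union_right
      have hv1 : 1 ≤ len v := by
        have := len_dvd (v4 (gen M y) (by rw [supp_gen]; simpa using hy) hyg hyg)
        rwa [len_gen] at this
      subst v2
      have h' : α' * g' = g' * β := by
        apply mo_cancel (a := v)
        rw [← mul_assoc, ← hα', mul_assoc, h, mul_assoc]
      rw [len_mul] at hg
      obtain ⟨i1, i2⟩ := ih g' (by omega) α' β h'
      have hcard := Set.ncard_le_ncard hs' (Set.toFinite _)
      refine ⟨i1.trans hcard, fun hle => ?_⟩
      have he : supp α' = supp α := Set.eq_of_subset_of_ncard_le hs' (hle.trans i1) (Set.toFinite _)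
      rw [he] at i2
      obtain ⟨u, ρ, h1, h2, h3, h4⟩ := i2 hle
      refine ⟨v * u, ρ, ?_, ?_, h3, h4⟩
      · rw [supp_mul]; exact Set.union_subset v1 h1
      · rw [h2, mul_assoc]
    · rcases mo_cases g with rfl | ⟨s, g1, hg1⟩
      · exact ih 1 (by rw [len_one]; omega) α β h
      have hsα : s ∉ supp α := fun hs => hA ⟨s, hs, ⟨g1, hg1⟩⟩
      obtain ⟨d, d1, d2, d3, d4⟩ := exists_d M (supp α)
      obtain ⟨v, ⟨-, ⟨g', v2⟩, v3⟩, v4⟩ := exists_gcd Set.univ (g := g) (d := d)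
      have hvg : v ∣ g := ⟨g', v2⟩
      have hvα : v ∣ α * g := hvg.trans (by rw [h]; exact Dvd.intro _ rfl)
      obtain ⟨c, -, c1⟩ := mo_lub Set.univ (Dvd.intro _ rfl : α ∣ α * g)
        hvα (Set.subset_univ _) (Set.subset_univ _)
      obtain ⟨f, rfl⟩ := c1.1
      have hfg : f ∣ g := dvd_cancel (c1.2.2 (α * g) (Dvd.intro _ rfl) hvα)
      obtain ⟨k1, k2, k3⟩ := chain_lemma d1 d2 d4 α v f subset_rfl v3 c1
      have hfv := v4 f (Set.subset_univ _) hfg k1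
      obtain ⟨-, k4⟩ := k3 (len_dvd hfv)
      choose! φ hφ using k4
      obtain ⟨α', hα', hsα'⟩ := push_right hφ α subset_rfl
      have hv1 : 1 ≤ len v := by
        have := len_dvd (v4 (gen M s) (Set.subset_univ _) ⟨g1, hg1⟩ (d3 s hsα))
        rwa [len_gen] at this
      subst v2
      have h' : α' * g' = g' * β := by
        apply mo_cancel (a := v)
        rw [← mul_assoc, ← hα', mul_assoc, h, mul_assoc]
      rw [len_mul] at hg
      obtain ⟨i1, i2⟩ := ih g' (by omega) α' β h'
      rw [hsα'] at i1 i2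
      have hcard := Set.ncard_image_le (f := φ) (Set.toFinite (supp α))
      refine ⟨i1.trans hcard, fun hle => ?_⟩
      obtain ⟨u, ρ, h1, h2, h3, h4⟩ := i2 (hcard.trans hle)
      obtain ⟨u', hu1, hu2⟩ := push_left hφ u h1
      refine ⟨u', v * ρ, hu2, ?_, ?_, ?_⟩
      · rw [h2, ← mul_assoc, hu1, mul_assoc]
      · intro y hy
        obtain ⟨b, hb, e⟩ := h3 (φ y) ⟨y, hy, rfl⟩
        exact ⟨b, hb, by rw [← mul_assoc, hφ y hy, mul_assoc, e, mul_assoc]⟩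
      · intro b hb
        obtain ⟨_, ⟨y, hy, rfl⟩, e⟩ := h4 b hb
        exact ⟨y, hy, by rw [← mul_assoc, hφ y hy, mul_assoc, e, mul_assoc]⟩

theorem part_two_symm {g α β : Mo M} (h : α * g = g * β) :
      ∃ u ρ, supp u ⊆ supp α ∧ g = u * ρ ∧
        (∀ y ∈ supp α, ∃ b ∈ supp β, gen M y * ρ = ρ * gen M b) ∧
        (∀ b ∈ supp β, ∃ y ∈ supp α, gen M y * ρ = ρ * gen M b) := by
  obtain ⟨g', k, h1, h2⟩ := exists_compl g
  refine (part_two (len g) g le_rfl α β h).2 (part_two (len g') g' le_rfl β α ?_).1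
  apply mo_cancel (a := g)
  rw [← mul_assoc, ← h, mul_assoc, h1, ← mul_assoc, h1, de_pow_central]

end PartTwo

end ArtinTits


namespace ArtinTits

section Embedding

variable {B : Type*} {M : CoxeterMatrix B} [Finite B] [Finite M.Group]

theorem σ_braid (s t : B) :
    altProd (σ M s) (σ M t) (M s t) = altProd (σ M t) (σ M s) (M s t) := by
  have h : PresentedGroup.mk (artinRelationsSet M)
      (altProd (FreeGroup.of s) (FreeGroup.of t) (M s t) *
        (altProd (FreeGroup.of t) (FreeGroup.of s) (M s t))⁻¹) = 1 :=
    PresentedGroup.one_of_mem ⟨s, t, M_ne_zero M s t, rfl⟩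
  rw [map_mul, map_inv, mul_inv_eq_one, map_altProd, map_altProd] at h
  exact h

/-- The canonical map from the Artin monoid to the Artin group. -/
noncomputable def io (M : CoxeterMatrix B) [Finite M.Group] : Mo M →* ArtinGroup M :=
  moLift (σ M) σ_braid

theorem io_gen (s : B) : io M (gen M s) = σ M s := moLift_gen _ _ s

/-- The powers of the central element. -/
noncomputable def dS (M : CoxeterMatrix B) [Finite M.Group] : Submonoid (Mo M) :=
  Submonoid.powers (de M)

theorem dS_central (m : Mo M) (s : dS M) : m * s = s * m := by
  obtain ⟨s, k, rfl⟩ := s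
  exact de_pow_central m k

noncomputable instance : OreLocalization.OreSet (dS M) where
  ore_right_cancel r₁ r₂ s h := ⟨s, by
    rw [← dS_central, ← dS_central]; exact h⟩
  oreNum r _ := r
  oreDenom _ s := s
  ore_eq r s := (dS_central r s).symm

theorem num_isUnit (m : Mo M) : IsUnit (OreLocalization.numeratorHom (S := dS M) m) := by
  obtain ⟨m', k, h1, h2⟩ := exists_compl m
  have hu : IsUnit (OreLocalization.numeratorHom (S := dS M) (de M ^ k)) :=
    OreLocalization.numerator_isUnit (⟨de M ^ k, k, rfl⟩ : dS M)
  have e1 := hu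
  have e2 := hu
  rw [← h1, map_mul] at e1
  rw [← h2, map_mul] at e2
  obtain ⟨u, hu⟩ := e1
  obtain ⟨v, hv⟩ := e2
  refine isUnit_iff_exists_and_exists.mpr ⟨⟨OreLocalization.numeratorHom (S := dS M) m' * (u⁻¹).val, ?_⟩,
    ⟨(v⁻¹).val * OreLocalization.numeratorHom (S := dS M) m', ?_⟩⟩
  · rw [← mul_assoc, ← hu, Units.mul_inv]
  · rw [mul_assoc, ← hv, Units.inv_mul]

theorem num_inj {a b : Mo M} (h : OreLocalization.numeratorHom (S := dS M) a =
    OreLocalization.numeratorHom (S := dS M) b) : a = b := by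
  rw [OreLocalization.numeratorHom_apply, OreLocalization.numeratorHom_apply,
    OreLocalization.oreDiv_eq_iff] at h
  obtain ⟨u, v, h1, h2⟩ := h
  have h3 : (u : Mo M) = v := by simpa using h2
  rw [← h3] at h1
  exact (mo_cancel h1).symm

theorem io_inj {a b : Mo M} (h : io M a = io M b) : a = b := by
  have hf : ∀ r ∈ artinRelationsSet M, FreeGroup.lift
      (fun s => (num_isUnit (gen M s)).unit) r = 1 := by
    rintro r ⟨s, t, -, rfl⟩
    rw [map_mul, map_inv, mul_inv_eq_one, map_altProd, map_altProd, FreeGroup.lift_apply_of,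
      FreeGroup.lift_apply_of]
    apply Units.ext
    rw [← Units.coeHom_apply, ← Units.coeHom_apply, map_altProd, map_altProd]
    simp only [Units.coeHom_apply, IsUnit.unit_spec]
    rw [← map_altProd, ← map_altProd, gen_braid]
  have key : ∀ m : Mo M, ((PresentedGroup.toGroup hf (io M m) : (OreLocalization (dS M) (Mo M))ˣ) :
      OreLocalization (dS M) (Mo M)) = OreLocalization.numeratorHom (S := dS M) m := by
    intro m
    induction m using mo_induction with
    | one => rw [map_one, map_one, map_one, Units.val_one]
    | step s m ih =>
      rw [map_mul, map_mul, Units.val_mul, ih, map_mul, io_gen]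
      congr 1
      have : PresentedGroup.toGroup hf (σ M s) = (num_isUnit (gen M s)).unit :=
        PresentedGroup.toGroup.of hf
      rw [this]; rfl
  apply num_inj
  rw [← key, ← key, h]

theorem A_induction {p : ArtinGroup M → Prop} (one : p 1) (mul : ∀ a b, p a → p b → p (a * b))
    (inv : ∀ a, p a → p a⁻¹) (g : ∀ s, p (σ M s)) (a : ArtinGroup M) : p a := by
  have ha : a ∈ Subgroup.closure (Set.range (PresentedGroup.of (rels := artinRelationsSet M))) := by
    rw [PresentedGroup.closure_range_of]; trivial
  induction ha using Subgroup.closure_induction with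
  | mem x hx => obtain ⟨s, rfl⟩ := hx; exact g s
  | one => exact one
  | mul a b _ _ ha hb => exact mul a b ha hb
  | inv a _ ha => exact inv a ha

theorem io_de_central (a : ArtinGroup M) (k : ℕ) : a * io M (de M ^ k) = io M (de M ^ k) * a := by
  change Commute a _
  induction a using A_induction with
  | one => exact Commute.one_left _
  | mul a b ha hb => exact ha.mul_left hb
  | inv a ha => exact ha.inv_left
  | g s =>
    rw [← io_gen]
    change _ * _ = _ * _
    rw [← map_mul, ← map_mul, de_pow_central]

theorem A_frac (a : ArtinGroup M) : ∃ m k, a * io M (de M ^ k) = io M m := by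
  induction a using A_induction with
  | one => exact ⟨1, 0, by simp⟩
  | mul a b ha hb =>
    obtain ⟨m, k, hm⟩ := ha
    obtain ⟨n, j, hn⟩ := hb
    refine ⟨m * n, k + j, ?_⟩
    rw [pow_add, map_mul, map_mul, mul_assoc, ← mul_assoc b, io_de_central b, mul_assoc, hn,
      ← mul_assoc, hm]
  | inv a ha =>
    obtain ⟨m, k, hm⟩ := ha
    obtain ⟨m', j, h1, h2⟩ := exists_compl m
    refine ⟨de M ^ k * m', j, ?_⟩
    rw [inv_mul_eq_iff_eq_mul, map_mul, ← mul_assoc, hm, ← map_mul, h1]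
  | g s => exact ⟨gen M s, 0, by simp [io_gen]⟩

theorem exists_xy (a : ArtinGroup M) : ∃ x y : Mo M, a * io M y = io M x ∧
    ∀ c e, a * io M e = io M c → ∃ w, c = x * w ∧ e = y * w := by
  obtain ⟨m, k, hm⟩ := A_frac a
  obtain ⟨m', j, h1, h2⟩ := exists_compl m
  obtain ⟨z, -, hz⟩ := mo_lub (m := de M ^ (k + j)) (a := de M ^ k) (b := m) Set.univ
    ⟨de M ^ j, pow_add _ _ _⟩ ⟨m' * de M ^ k, by rw [← mul_assoc, h1, add_comm, pow_add]⟩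
    (Set.subset_univ _) (Set.subset_univ _)
  obtain ⟨x, rfl⟩ := hz.1
  obtain ⟨y, hy⟩ := hz.2.1
  have e1 : a * io M y = io M x := by
    have : io M (de M ^ k) * (a * io M y) = io M (de M ^ k) * io M x := by
      rw [← mul_assoc, ← io_de_central, hm, ← map_mul, ← map_mul, hy]
    exact mul_left_cancel this
  refine ⟨x, y, e1, fun c e h => ?_⟩
  have h3 : de M ^ k * c = m * e := by
    apply io_inj
    rw [map_mul, map_mul, ← h, ← mul_assoc, ← io_de_central, hm]
  obtain ⟨w, hw⟩ := hz.2.2 (de M ^ k * c) (Dvd.intro _ rfl) ⟨e, h3⟩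
  refine ⟨w, ?_, ?_⟩
  · rw [mul_assoc] at hw; exact mo_cancel hw
  · rw [h3, hy, mul_assoc] at hw; exact mo_cancel hw

/-- The minimal positive numerator. -/
noncomputable def nx (a : ArtinGroup M) : Mo M := (exists_xy a).choose

/-- The minimal positive denominator. -/
noncomputable def ny (a : ArtinGroup M) : Mo M := (exists_xy a).choose_spec.choose

theorem nxy (a : ArtinGroup M) : a * io M (ny a) = io M (nx a) :=
  (exists_xy a).choose_spec.choose_spec.1

theorem nxy_min {a : ArtinGroup M} {c e : Mo M} (h : a * io M e = io M c) :
    ∃ w, c = nx a * w ∧ e = ny a * w := (exists_xy a).choose_spec.choose_spec.2 c e h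

theorem io_mem {X : Set B} (m : Mo M) : supp m ⊆ X → io M m ∈ AP M X := by
  induction m using mo_induction with
  | one => intro _; rw [map_one]; exact one_mem _
  | step s m ih =>
    intro h
    rw [supp_mul, supp_gen, Set.union_subset_iff, Set.singleton_subset_iff] at h
    rw [map_mul, io_gen]
    exact mul_mem (Subgroup.subset_closure ⟨s, h.1, rfl⟩) (ih h.2)

theorem AP_frac {X : Set B} {a : ArtinGroup M} (h : a ∈ AP M X) :
    ∃ u v, supp u ⊆ X ∧ supp v ⊆ X ∧ a * io M v = io M u := by
  induction h using Subgroup.closure_induction with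
  | mem x hx =>
    obtain ⟨s, hs, rfl⟩ := hx
    exact ⟨gen M s, 1, by rw [supp_gen]; simpa using hs, by simp [supp_one], by simp [io_gen]⟩
  | one => exact ⟨1, 1, by simp [supp_one], by simp [supp_one], by simp⟩
  | mul a b _ _ ha hb =>
    obtain ⟨u, v, h1, h2, h3⟩ := ha
    obtain ⟨u', v', k1, k2, k3⟩ := hb
    obtain ⟨m, i, hm, -⟩ := exists_compl v
    obtain ⟨m', j, hm', -⟩ := exists_compl u'
    obtain ⟨z, hz, ⟨p, hp⟩, ⟨q, hq⟩, -⟩ := mo_lub (m := de M ^ (i + j)) X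
      ⟨m * de M ^ j, by rw [← mul_assoc, hm, pow_add]⟩
      ⟨m' * de M ^ i, by rw [← mul_assoc, hm', add_comm, pow_add]⟩ h2 k1
    refine ⟨u * p, v' * q, ?_, ?_, ?_⟩
    · rw [supp_mul]
      refine Set.union_subset h1 ?_
      rw [hp, supp_mul] at hz; exact Set.subset_union_right.trans hz
    · rw [supp_mul]
      refine Set.union_subset k2 ?_
      rw [hq, supp_mul] at hz; exact Set.subset_union_right.trans hz
    · rw [map_mul, ← mul_assoc, mul_assoc a, k3, mul_assoc, ← map_mul, ← hq, hp, map_mul,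
        ← mul_assoc, h3, map_mul]
  | inv a _ ha =>
    obtain ⟨u, v, h1, h2, h3⟩ := ha
    exact ⟨v, u, h2, h1, by rw [← h3, inv_mul_cancel_left]⟩

theorem supp_nxy {X : Set B} {a : ArtinGroup M} (h : a ∈ AP M X) :
    supp (nx a) ⊆ X ∧ supp (ny a) ⊆ X := by
  obtain ⟨u, v, h1, h2, h3⟩ := AP_frac h
  obtain ⟨w, rfl, rfl⟩ := nxy_min h3
  rw [supp_mul] at h1 h2
  exact ⟨Set.subset_union_left.trans h1, Set.subset_union_left.trans h2⟩

/-- The state of the simultaneous transport iteration. -/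
structure St (M : CoxeterMatrix B) [Finite M.Group] (X : Set B) (a₀ b₀ : ArtinGroup M)
    (k : ℕ) where
  a : ArtinGroup M
  b : ArtinGroup M
  g : Mo M
  ha : a ∈ AP M X
  hb : b ∈ AP M X
  hg : a * io M g = io M g * b
  hk : ∃ h, g * h = de M ^ k ∧ b * io M h = io M h * a
  ca : ∃ c ∈ AP M X, c⁻¹ * a₀ * c = a
  cb : ∃ c ∈ AP M X, c⁻¹ * b₀ * c = b

theorem transport {a b : ArtinGroup M} {g : Mo M} (h : a * io M g = io M g * b) :
    ∃ g', nx a * g' = g * nx b ∧ ny a * g' = g * ny b ∧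
      ((io M (nx a))⁻¹ * a * io M (nx a)) * io M g' =
        io M g' * ((io M (nx b))⁻¹ * b * io M (nx b)) := by
  obtain ⟨w, h1, h2⟩ := nxy_min (a := a) (c := g * nx b) (e := g * ny b) (by
    rw [map_mul, ← mul_assoc, h, mul_assoc, nxy, map_mul])
  refine ⟨w, h1.symm, h2.symm, ?_⟩
  have h3 : io M (nx a) * io M w = io M g * io M (nx b) := by rw [← map_mul, ← h1, map_mul]
  have h4 : io M w = (io M (nx a))⁻¹ * io M g * io M (nx b) := by
    rw [mul_assoc, ← h3, inv_mul_cancel_left]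
  have h5 : a = io M g * b * (io M g)⁻¹ := by rw [← h, mul_inv_cancel_right]
  rw [h4, h5]
  group

theorem St_step {X : Set B} {a₀ b₀ : ArtinGroup M} {k : ℕ} (s : St M X a₀ b₀ k) :
    ∃ s' : St M X a₀ b₀ k, nx s.a * s'.g = s.g * nx s.b ∧ ny s.a * s'.g = s.g * ny s.b := by
  obtain ⟨a, b, g, ha, hb, hg, ⟨h, hh, hh'⟩, ⟨c, hc, hc'⟩, ⟨d, hd, hd'⟩⟩ := s
  obtain ⟨g', h1, h2, h3⟩ := transport hg
  obtain ⟨h', k1, k2, k3⟩ := transport hh'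
  have mx := io_mem _ (supp_nxy ha).1
  have my := io_mem _ (supp_nxy hb).1
  refine ⟨⟨_, _, g', ?_, ?_, h3, ⟨h', ?_, k3⟩, ⟨c * io M (nx a), mul_mem hc mx, ?_⟩,
    ⟨d * io M (nx b), mul_mem hd my, ?_⟩⟩, h1, h2⟩
  · exact mul_mem (mul_mem (inv_mem mx) ha) mx
  · exact mul_mem (mul_mem (inv_mem my) hb) my
  · apply mo_cancel (a := nx a)
    rw [← mul_assoc, h1, mul_assoc, k1, ← mul_assoc, hh, de_pow_central]
  · rw [← hc']; group
  · rw [← hd']; group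

theorem exists_loop {X : Set B} {a₀ b₀ : ArtinGroup M} {k : ℕ} (s₀ : St M X a₀ b₀ k) :
    ∃ s : St M X a₀ b₀ k, ∃ α β : Mo M, supp α ⊆ X ∧ supp β ⊆ X ∧ α * s.g = s.g * β ∧
      supp (nx s.a) ⊆ supp α ∧ supp (ny s.a) ⊆ supp α := by
  choose F hF1 hF2 using St_step (M := M) (X := X) (a₀ := a₀) (b₀ := b₀) (k := k)
  let f : ℕ → St M X a₀ b₀ k := fun n => F^[n] s₀
  have hf : ∀ n, f (n + 1) = F (f n) := fun n => Function.iterate_succ_apply' F n s₀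
  have hlen : ∀ n, len (f n).g ≤ len (de M ^ k) := by
    intro n
    obtain ⟨h, hh, -⟩ := (f n).hk
    exact len_dvd ⟨h, hh.symm⟩
  have hfin : Finite {m : Mo M | len m ≤ len (de M ^ k)} := finite_len M _
  have hex : ∃ i j, i < j ∧ (f i).g = (f j).g := by
    obtain ⟨i, j, hij, he⟩ := Finite.exists_ne_map_eq_of_infinite
      (fun n => (⟨(f n).g, hlen n⟩ : {m : Mo M | len m ≤ len (de M ^ k)}))
    have he' : (f i).g = (f j).g := congrArg Subtype.val he
    rcases lt_or_gt_of_ne hij with h | h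
    · exact ⟨i, j, h, he'⟩
    · exact ⟨j, i, h, he'.symm⟩
  obtain ⟨i, j, hij, he⟩ := hex
  obtain ⟨n, rfl⟩ : ∃ n, j = i + n + 1 := ⟨j - i - 1, by omega⟩
  have main : ∀ n, ∃ P Q C D : Mo M, supp P ⊆ X ∧ supp Q ⊆ X ∧ supp C ⊆ X ∧ supp D ⊆ X ∧
      P * (f (i + n + 1)).g = (f i).g * C ∧ Q * (f (i + n + 1)).g = (f i).g * D ∧
      nx (f i).a ∣ P ∧ ny (f i).a ∣ Q := by
    intro n
    induction n with
    | zero =>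
      refine ⟨nx (f i).a, ny (f i).a, nx (f i).b, ny (f i).b, (supp_nxy (f i).ha).1,
        (supp_nxy (f i).ha).2, (supp_nxy (f i).hb).1, (supp_nxy (f i).hb).2, ?_, ?_, dvd_rfl, dvd_rfl⟩
      · rw [add_zero, hf]; exact hF1 _
      · rw [add_zero, hf]; exact hF2 _
    | succ n ih =>
      obtain ⟨P, Q, C, D, h1, h2, h3, h4, h5, h6, h7, h8⟩ := ih
      have e : i + (n + 1) + 1 = i + n + 1 + 1 := by omega
      rw [e, hf (i + n + 1)]
      set t := f (i + n + 1)
      refine ⟨P * nx t.a, Q * ny t.a, C * nx t.b, D * ny t.b, ?_, ?_, ?_, ?_, ?_, ?_,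
        h7.mul_right _, h8.mul_right _⟩
      · rw [supp_mul]; exact Set.union_subset h1 (supp_nxy t.ha).1
      · rw [supp_mul]; exact Set.union_subset h2 (supp_nxy t.ha).2
      · rw [supp_mul]; exact Set.union_subset h3 (supp_nxy t.hb).1
      · rw [supp_mul]; exact Set.union_subset h4 (supp_nxy t.hb).2
      · rw [mul_assoc, hF1, ← mul_assoc, h5, mul_assoc]
      · rw [mul_assoc, hF2, ← mul_assoc, h6, mul_assoc]
  obtain ⟨P, Q, C, D, h1, h2, h3, h4, h5, h6, h7, h8⟩ := main n
  rw [← he] at h5 h6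
  refine ⟨f i, P * Q, C * D, ?_, ?_, ?_, ?_, ?_⟩
  · rw [supp_mul]; exact Set.union_subset h1 h2
  · rw [supp_mul]; exact Set.union_subset h3 h4
  · rw [mul_assoc, h6, ← mul_assoc, h5, mul_assoc]
  · rw [supp_mul]; exact (supp_dvd h7).trans Set.subset_union_left
  · rw [supp_mul]; exact (supp_dvd h8).trans Set.subset_union_right

theorem main_theorem {X : Set B} (hstar : StarA M X) : IsConjugacyStable (AP M X) := by
  rintro a₀ b₀ ha₀ hb₀ ⟨g₀, hg₀⟩
  obtain ⟨m, k, hm⟩ := A_frac g₀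
  have hm1 : a₀ * io M m = io M m * b₀ := by
    rw [← hm, ← hg₀]
    have := io_de_central (g₀⁻¹ * a₀ * g₀) k
    rw [mul_assoc g₀, ← this]
    group
  obtain ⟨m', j, h1, h2⟩ := exists_compl m
  have hm2 : b₀ * io M m' = io M m' * a₀ := by
    have e : io M m * (b₀ * io M m') = io M m * (io M m' * a₀) := by
      rw [← mul_assoc, ← hm1, mul_assoc, ← map_mul, h1, io_de_central, ← h1, map_mul, mul_assoc]
    exact mul_left_cancel e
  obtain ⟨⟨a, b, g, ha, hb, hg, _, ⟨c, hc, hc'⟩, ⟨d, hd, hd'⟩⟩, α, β, hα, hβ, hαβ, hx, hy⟩ :=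
    exists_loop (M := M) (X := X) (a₀ := a₀) (b₀ := b₀) (k := j)
    ⟨a₀, b₀, m, ha₀, hb₀, hm1, ⟨m', h1, hm2⟩, ⟨1, one_mem _, by simp⟩, ⟨1, one_mem _, by simp⟩⟩
  change α * g = g * β at hαβ
  change supp (nx a) ⊆ supp α at hx
  change supp (ny a) ⊆ supp α at hy
  obtain ⟨u, ρ, hu, rfl, k1, k2⟩ := part_two_symm hαβ
  have conv : ∀ y b : B, gen M y * ρ = ρ * gen M b →
      (io M ρ)⁻¹ * σ M y * io M ρ = σ M b := by
    intro y b h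
    rw [mul_assoc, inv_mul_eq_iff_eq_mul, ← io_gen, ← io_gen, ← map_mul, h, map_mul]
  obtain ⟨h, hh, hh'⟩ := hstar (supp α) (supp β) hα hβ (io M ρ) (by
    ext z
    constructor
    · rintro ⟨_, ⟨y, hy, rfl⟩, rfl⟩
      obtain ⟨b, hb, e⟩ := k1 y hy
      exact ⟨b, hb, (conv y b e).symm⟩
    · rintro ⟨b, hb, rfl⟩
      obtain ⟨y, hy, e⟩ := k2 b hb
      exact ⟨_, ⟨y, hy, rfl⟩, conv y b e⟩)
  have hcent : AP M (supp α) ≤ Subgroup.centralizer {io M ρ * h⁻¹} := by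
    unfold AP
    rw [Subgroup.closure_le]
    rintro _ ⟨y, hy, rfl⟩
    rw [SetLike.mem_coe, Subgroup.mem_centralizer_singleton_iff]
    have e := hh' y hy
    have e2 : σ M y = (io M ρ * h⁻¹) * σ M y * (io M ρ * h⁻¹)⁻¹ := by
      calc σ M y = io M ρ * ((io M ρ)⁻¹ * σ M y * io M ρ) * (io M ρ)⁻¹ := by group
        _ = _ := by rw [← e]; group
    first
    | exact mul_inv_eq_iff_eq_mul.mp e2.symm
    | exact (mul_inv_eq_iff_eq_mul.mp e2.symm).symm
  have hmem : (io M u)⁻¹ * a * io M u ∈ AP M (supp α) := by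
    have e : a = io M (nx a) * (io M (ny a))⁻¹ := by rw [← nxy, mul_inv_cancel_right]
    have m1 : a ∈ AP M (supp α) := by
      rw [e]; exact mul_mem (io_mem _ hx) (inv_mem (io_mem _ hy))
    exact mul_mem (mul_mem (inv_mem (io_mem _ hu)) m1) (io_mem _ hu)
  have hcomm := Subgroup.mem_centralizer_singleton_iff.mp (hcent hmem)
  set q := (io M u)⁻¹ * a * io M u with hq
  have hcomm' : h⁻¹ * q * h = (io M ρ)⁻¹ * q * io M ρ := by
    have e3 : io M ρ * h⁻¹ * q = q * (io M ρ * h⁻¹) := by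
      first
      | exact hcomm
      | exact hcomm.symm
    calc h⁻¹ * q * h = (io M ρ)⁻¹ * (io M ρ * h⁻¹ * q) * h := by group
      _ = _ := by rw [e3]; group
  have hb' : b = h⁻¹ * q * h := by
    rw [hcomm', hq]
    calc b = (io M (u * ρ))⁻¹ * (io M (u * ρ) * b) := by group
      _ = _ := by rw [← hg, map_mul]; group
  refine ⟨c * (io M u * h) * d⁻¹, mul_mem (mul_mem hc (mul_mem (io_mem _ (hu.trans hα)) hh))
    (inv_mem hd), ?_⟩
  have hb0 : b₀ = d * b * d⁻¹ := by rw [← hd']; group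
  rw [hb0, hb', hq, ← hc']
  group

end Embedding

end ArtinTits

namespace ArtinTits

/-- Proposition 3 of the paper: for Artin–Tits groups of spherical type, Property `⋆_A`
implies conjugacy stability of `A_X` in `A_S`. -/
theorem conjugacy_stable_of_starA
    {B : Type*} [Finite B] (M : CoxeterMatrix B) [Finite M.Group]
    (X : Set B) (hX : X.Nonempty) (hXproper : X ≠ Set.univ)
    (hstar : StarA M X) :
    IsConjugacyStable (AP M X) := by
  exact main_theorem hstar

end ArtinTits
end

section
/- Let W_S be a finite Coxeter group with connected Coxeter graph, and let X be a nonempty proper subset of S such that W_X is of type B_n (some n ≥ 2). Then the pair (W_X, W_S) satisfies Property ⋆_W. -/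
namespace ArtinTits
open Module

set_option linter.unusedSectionVars false

section Rep
variable {B : Type*} [Fintype B] [DecidableEq B] (M : CoxeterMatrix B)

/-- Entries of the cosine matrix. -/
noncomputable def kk (s t : B) : ℝ := -Real.cos (Real.pi / M s t)

theorem kk_self (s : B) : kk M s s = 1 := by simp [kk]

theorem kk_symm (s t : B) : kk M s t = kk M t s := by simp [kk, M.symmetric s t]

theorem kk_nonpos {s t : B} (h : s ≠ t) : kk M s t ≤ 0 := by
  have h1 := M.off_diagonal s t h
  unfold kk
  rw [neg_nonpos]
  rcases Nat.eq_zero_or_pos (M s t) with h0 | h0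
  · simp [h0]
  have h2 : (2 : ℝ) ≤ M s t := by exact_mod_cast (by omega : 2 ≤ M s t)
  apply Real.cos_nonneg_of_neg_pi_div_two_le_of_le
  · have : 0 ≤ Real.pi / M s t := by positivity
    linarith [Real.pi_pos]
  · exact div_le_div_of_nonneg_left Real.pi_pos.le (by norm_num) h2

theorem kk_le_half {s t : B} (h : s ≠ t) (h' : M s t ≠ 2) : kk M s t ≤ -(1/2) := by
  have h1 := M.off_diagonal s t h
  unfold kk
  rw [neg_le_neg_iff]
  rcases Nat.eq_zero_or_pos (M s t) with h0 | h0
  · simp [h0]; norm_num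
  have h2 : (3 : ℝ) ≤ M s t := by exact_mod_cast (by omega : 3 ≤ M s t)
  rw [← Real.cos_pi_div_three]
  apply Real.cos_le_cos_of_nonneg_of_le_pi
  · positivity
  · linarith [Real.pi_pos]
  · exact div_le_div_of_nonneg_left Real.pi_pos.le (by norm_num) h2

theorem kk_four {s t : B} (h' : M s t = 4) : kk M s t = -(√2 / 2) := by
  simp [kk, h']

/-- The linear form attached to a simple root. -/
noncomputable def ff (s : B) : Dual ℝ (B → ℝ) :=
  ∑ t, (2 * kk M s t) • LinearMap.proj t

theorem ff_single (s t : B) : ff M s (Pi.single t 1) = 2 * kk M s t := by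
  simp [ff, Pi.single_apply]

theorem ff_self (s : B) : ff M s (Pi.single s 1) = 2 := by
  rw [ff_single, kk_self]; norm_num

noncomputable def rr (s : B) : (B → ℝ) ≃ₗ[ℝ] (B → ℝ) := reflection (ff_self M s)

theorem rr_apply (s : B) (v : B → ℝ) : rr M s v = v - ff M s v • Pi.single s 1 :=
  reflection_apply _ _

theorem rr_sq (s : B) : rr M s * rr M s = 1 := by
  ext v : 1
  exact involutive_reflection (ff_self M s) v

theorem rr_single (s t : B) :
    rr M s (Pi.single t 1) = Pi.single t 1 - (2 * kk M s t) • Pi.single s 1 := by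
  rw [rr_apply, ff_single]

theorem S_vanish (m : ℕ) (hm : 3 ≤ m) (t : ℝ) (ht : t = 2 * Real.cos (2 * Real.pi / m)) :
    ((Polynomial.Chebyshev.S ℝ (((m:ℤ) - 2) / 2)).eval t *
      ((Polynomial.Chebyshev.S ℝ (((m:ℤ) - 1) / 2)).eval t
        + (Polynomial.Chebyshev.S ℝ (((m:ℤ) - 3) / 2)).eval t)) = 0 ∧
    ((Polynomial.Chebyshev.S ℝ (((m:ℤ) - 1) / 2)).eval t *
      ((Polynomial.Chebyshev.S ℝ ((m:ℤ) / 2)).eval t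
        + (Polynomial.Chebyshev.S ℝ (((m:ℤ) - 2) / 2)).eval t)) = 0 := by
  set θ := 2 * Real.pi / m with hθ
  have hm' : (3:ℝ) ≤ m := by exact_mod_cast hm
  have hs : 0 < Real.sin θ := by
    apply Real.sin_pos_of_pos_of_lt_pi
    · have := Real.pi_pos
      positivity
    · rw [hθ, div_lt_iff₀ (by linarith)]
      nlinarith [Real.pi_pos]
  have key : ∀ k : ℤ, (Polynomial.Chebyshev.S ℝ k).eval t * Real.sin θ = Real.sin ((k+1) * θ) := by
    intro k; rw [ht]; exact Polynomial.Chebyshev.S_two_mul_real_cos θ k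
  obtain ⟨j, hj | hj⟩ := Nat.even_or_odd' m
  · have e1 : ((m:ℤ) - 2) / 2 = j - 1 := by omega
    have e2 : ((m:ℤ) - 1) / 2 = j - 1 := by omega
    have z : (Polynomial.Chebyshev.S ℝ ((j:ℤ) - 1)).eval t = 0 := by
      have := key (j - 1)
      have h2 : (((j:ℤ) - 1 : ℤ) + 1 : ℝ) * θ = Real.pi := by
        have hj' : (m:ℝ) = 2 * j := by exact_mod_cast hj
        rw [hθ, hj']
        have : (j:ℝ) ≠ 0 := by intro h; rw [h] at hj'; linarith
        push_cast
        field_simp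
        ring
      rw [h2, Real.sin_pi] at this
      exact (mul_eq_zero.mp this).resolve_right hs.ne'
    rw [e1, e2, z]; simp
  · have e1 : ((m:ℤ) - 2) / 2 = j - 1 := by omega
    have e2 : ((m:ℤ) - 1) / 2 = j := by omega
    have e3 : ((m:ℤ) - 3) / 2 = j - 1 := by omega
    have e4 : (m:ℤ) / 2 = j := by omega
    have z : (Polynomial.Chebyshev.S ℝ (j:ℤ)).eval t
        + (Polynomial.Chebyshev.S ℝ ((j:ℤ) - 1)).eval t = 0 := by
      have h1 := key (j - 1)
      have h2 := key j
      have h3 : Real.sin (((j:ℤ) + 1 : ℝ) * θ) = - Real.sin ((((j:ℤ) - 1 : ℤ) + 1 : ℝ) * θ) := by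
        rw [← Real.sin_neg, ← Real.sin_add_two_pi (-_)]
        congr 1
        have hj' : (m:ℝ) = 2 * j + 1 := by exact_mod_cast hj
        rw [hθ, hj']
        have : (2 * j + 1:ℝ) ≠ 0 := by positivity
        push_cast
        field_simp
        ring
      have : ((Polynomial.Chebyshev.S ℝ (j:ℤ)).eval t
        + (Polynomial.Chebyshev.S ℝ ((j:ℤ) - 1)).eval t) * Real.sin θ = 0 := by
        rw [add_mul, h1, h2, h3]; ring
      exact (mul_eq_zero.mp this).resolve_right hs.ne'
    rw [e1, e2, e3, e4, z]; simp

theorem rr_liftable : M.IsLiftable (rr M) := by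
  intro s t
  by_cases hst : s = t
  · subst hst; rw [rr_sq, one_pow]
  have h1 := M.off_diagonal s t hst
  rcases Nat.eq_zero_or_pos (M s t) with h0 | h0
  · rw [h0, pow_zero]
  by_cases h2 : M s t = 2
  · have hk : kk M s t = 0 := by simp [kk, h2]
    have hk' : kk M t s = 0 := by rw [kk_symm, hk]
    have hc : rr M s * rr M t = rr M t * rr M s := by
      ext v : 1
      simp only [LinearEquiv.mul_apply, rr_apply, map_sub, map_smul, ff_single, hk, hk']
      module
    rw [h2, pow_two]
    calc rr M s * rr M t * (rr M s * rr M t) = rr M s * (rr M t * rr M s) * rr M t := by group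
      _ = 1 := by
        rw [← hc, ← mul_assoc, rr_sq, one_mul, rr_sq]
  have h3 : 3 ≤ M s t := by omega
  have := reflection_mul_reflection_pow (ff_self M s) (ff_self M t) (M s t)
  obtain ⟨a, b⟩ := S_vanish (M s t) h3 (ff M s (Pi.single t 1) * ff M t (Pi.single s 1) - 2) (by
    rw [ff_single, ff_single, kk_symm M t s, mul_div_assoc, Real.cos_two_mul]
    unfold kk; ring)
  rw [a, b] at this
  simp only [zero_smul, add_zero] at this
  ext1 v
  exact LinearMap.congr_fun this v

/-- The geometric representation. -/
noncomputable def rho : M.Group →* ((B → ℝ) ≃ₗ[ℝ] (B → ℝ)) :=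
  M.toCoxeterSystem.lift ⟨rr M, rr_liftable M⟩

theorem rho_simple (s : B) : rho M (M.simple s) = rr M s := by
  rw [← M.toCoxeterSystem_simple]
  exact M.toCoxeterSystem.lift_apply_simple (rr_liftable M) s

theorem simple_inj_s8 {s t : B} (h : M.simple s = M.simple t) : s = t := by
  by_contra hne
  have h1 : rr M s = rr M t := by rw [← rho_simple, ← rho_simple, h]
  have h2 := congrFun (LinearEquiv.congr_fun h1 (Pi.single s 1)) s
  rw [rr_single, rr_single, kk_self] at h2
  simp [hne] at h2

theorem kk_zero_of_commute {s t : B} (hne : s ≠ t)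
    (h : M.simple s * M.simple t = M.simple t * M.simple s) : kk M s t = 0 := by
  have h1 : rr M s * rr M t = rr M t * rr M s := by
    rw [← rho_simple, ← rho_simple, ← map_mul, ← map_mul, h]
  have h2 := congrFun (LinearEquiv.congr_fun h1 (Pi.single t 1)) t
  simp only [LinearEquiv.mul_apply, rr_single, map_sub, map_smul, kk_self] at h2
  simp [hne, hne.symm, Pi.single_apply, kk_symm M t s] at h2
  nlinarith

theorem M_two_of_commute {s t : B} (hne : s ≠ t)
    (h : M.simple s * M.simple t = M.simple t * M.simple s) : M s t = 2 := by
  by_contra h2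
  have := kk_le_half M hne h2
  rw [kk_zero_of_commute M hne h] at this
  norm_num at this

/-- An invariant positive definite form. -/
noncomputable def II [Fintype M.Group] (u v : B → ℝ) : ℝ :=
  ∑ w : M.Group, (rho M w u) ⬝ᵥ (rho M w v)

theorem II_inv [Fintype M.Group] (g : M.Group) (u v : B → ℝ) :
    II M (rho M g u) (rho M g v) = II M u v := by
  unfold II
  rw [← Equiv.sum_comp (Equiv.mulRight g) (fun w => (rho M w u) ⬝ᵥ (rho M w v))]
  simp [LinearEquiv.mul_apply]

theorem II_sub_left [Fintype M.Group] (a b v : B → ℝ) : II M (a - b) v = II M a v - II M b v := by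
  simp [II, sub_dotProduct, Finset.sum_sub_distrib]

theorem II_smul_left [Fintype M.Group] (c : ℝ) (a v : B → ℝ) : II M (c • a) v = c * II M a v := by
  simp [II, Finset.mul_sum]

theorem II_neg_right [Fintype M.Group] (a v : B → ℝ) : II M a (-v) = - II M a v := by
  simp [II]

theorem II_symm [Fintype M.Group] (a v : B → ℝ) : II M a v = II M v a := by
  simp [II, dotProduct_comm]

theorem II_sum_left [Fintype M.Group] (F : Finset B) (g : B → B → ℝ) (v : B → ℝ) :
    II M (∑ i ∈ F, g i) v = ∑ i ∈ F, II M (g i) v := by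
  simp only [II, map_sum, sum_dotProduct]
  rw [Finset.sum_comm]

theorem II_nonneg [Fintype M.Group] (a : B → ℝ) : 0 ≤ II M a a :=
  Finset.sum_nonneg fun w _ => Finset.sum_nonneg fun i _ => mul_self_nonneg _

theorem II_pos [Fintype M.Group] (s : B) : 0 < II M (Pi.single s 1) (Pi.single s 1) := by
  refine Finset.sum_pos' (fun w _ => Finset.sum_nonneg fun i _ => mul_self_nonneg _)
    ⟨1, Finset.mem_univ _, ?_⟩
  simp

theorem II_single [Fintype M.Group] (s t : B) : II M (Pi.single t 1) (Pi.single s 1)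
    = kk M s t * II M (Pi.single s 1) (Pi.single s 1) := by
  have h := II_inv M (M.simple s) (Pi.single t 1) (Pi.single s 1)
  rw [rho_simple, rr_apply M s (Pi.single s 1), ff_self, rr_single] at h
  have e : (Pi.single s 1 - (2:ℝ) • Pi.single s 1 : B → ℝ) = - Pi.single s 1 := by module
  rw [e, II_neg_right, II_sub_left, II_smul_left] at h
  linarith

theorem kk_sum_nonneg [Finite M.Group] (hconn : ConnectedIn M Set.univ) (F : Finset B) :
    0 ≤ ∑ s ∈ F, ∑ t ∈ F, kk M s t := by
  classical
  have := Fintype.ofFinite M.Group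
  have hc : ∀ s t, II M (Pi.single s 1) (Pi.single s 1) = II M (Pi.single t 1) (Pi.single t 1) := by
    intro s t
    have := hconn s trivial t trivial
    unfold ReachIn at this
    induction this with
    | refl => rfl
    | tail _ h ih =>
      rename_i b c _
      rw [ih]
      obtain ⟨_, _, hne, hm⟩ := h
      have h1 := II_single M b c
      rw [II_symm, II_single M c b, kk_symm] at h1
      have h2 := kk_le_half M hne hm
      exact (mul_left_cancel₀ (by linarith) h1).symm
  rcases F.eq_empty_or_nonempty with rfl | ⟨a, ha⟩
  · simp
  have h1 := II_nonneg M (∑ i ∈ F, Pi.single i 1)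
  have h2 : II M (∑ i ∈ F, Pi.single i 1) (∑ i ∈ F, Pi.single i 1)
     = (∑ s ∈ F, ∑ t ∈ F, kk M s t) * II M (Pi.single a 1) (Pi.single a 1) := by
    rw [II_sum_left, Finset.sum_mul]
    apply Finset.sum_congr rfl
    intro s _
    rw [II_symm, II_sum_left, Finset.sum_mul]
    apply Finset.sum_congr rfl
    intro t _
    rw [II_single, hc s a]
  rw [h2] at h1
  exact nonneg_of_mul_nonneg_left h1 (II_pos M a)

/-- Connectedness by odd edges. -/
def OddReach (s t : B) : Prop := Relation.ReflTransGen (fun a b => Odd (M a b)) s t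

theorem not_oddReach [Finite M.Group] (hconn : ConnectedIn M Set.univ) {s t : B}
    (h4 : M s t = 4) : ¬ OddReach M s t := by
  intro h
  have hst : s ≠ t := by rintro rfl; simp at h4
  -- the form with the edge `s, t` removed
  let q : B → B → ℝ := fun a b => if (a = s ∧ b = t) ∨ (a = t ∧ b = s) then 0 else kk M a b
  have qs : ∀ a b, q a b = q b a := by
    intro a b
    simp only [q, kk_symm M a b]
    congr 1
    apply propext; tauto
  have qn : ∀ a b, a ≠ b → q a b ≤ 0 := by
    intro a b hab
    simp only [q]
    split_ifs
    · rfl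
    · exact kk_nonpos M hab
  have key : ∀ u, OddReach M s u → ∃ F : Finset B, s ∈ F ∧ u ∈ F ∧ ∑ a ∈ F, ∑ b ∈ F, q a b ≤ 1 := by
    intro u hu
    induction hu with
    | refl => exact ⟨{s}, by simp, by simp, by simp [q, hst, kk_self]⟩
    | tail _ hodd ih =>
      rename_i b c _
      obtain ⟨F, hs, hb, hF⟩ := ih
      by_cases hc : c ∈ F
      · exact ⟨F, hs, hc, hF⟩
      refine ⟨insert c F, by simp [hs], by simp, ?_⟩
      have hbc : b ≠ c := by rintro rfl; exact hc hb
      have h1 : q b c ≤ -(1/2) := by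
        have : ¬ ((b = s ∧ c = t) ∨ (b = t ∧ c = s)) := by
          rintro (⟨rfl, rfl⟩ | ⟨rfl, rfl⟩)
          · rw [h4] at hodd; exact absurd hodd (by decide)
          · exact hc hs
        simp only [q, this, if_false]
        apply kk_le_half M hbc
        intro h2; rw [h2] at hodd; exact absurd hodd (by decide)
      have h2 : ∑ a ∈ F, q c a ≤ -(1/2) := by
        rw [← Finset.add_sum_erase _ _ hb, qs]
        have : ∑ a ∈ F.erase b, q c a ≤ 0 := Finset.sum_nonpos (fun a ha => qn _ _ (by
          rintro rfl; exact hc (Finset.mem_of_mem_erase ha)))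
        linarith
      have h3 : q c c = 1 := by
        have : ¬ ((c = s ∧ c = t) ∨ (c = t ∧ c = s)) := by
          rintro (⟨h5, h6⟩ | ⟨h5, h6⟩)
          · exact hst (h5.symm.trans h6)
          · exact hst (h6.symm.trans h5)
        simp only [q, this, if_false, kk_self]
      rw [Finset.sum_insert hc, Finset.sum_insert hc, h3]
      simp only [Finset.sum_insert hc, Finset.sum_add_distrib]
      have h4 : ∑ a ∈ F, q a c = ∑ a ∈ F, q c a := Finset.sum_congr rfl fun a _ => qs _ _
      rw [h4]
      linarith
  obtain ⟨F, hs, ht, hF⟩ := key t h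
  have h0 := kk_sum_nonneg M hconn F
  have e : ∀ a b, kk M a b = q a b + ((if a = s then (if b = t then -(√2/2) else 0) else 0)
      + (if a = t then (if b = s then -(√2/2) else 0) else 0)) := by
    intro a b
    simp only [q]
    by_cases h1 : a = s ∧ b = t
    · obtain ⟨rfl, rfl⟩ := h1
      simp [hst, kk_four M h4]
    by_cases h2 : a = t ∧ b = s
    · obtain ⟨rfl, rfl⟩ := h2
      simp [hst, hst.symm, kk_symm M a b, kk_four M h4]
    simp only [h1, h2, or_self, if_false, ← ite_and]
    simp
  have h2 : ∑ a ∈ F, ∑ b ∈ F, kk M a b = ∑ a ∈ F, ∑ b ∈ F, q a b - √2 := by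
    simp only [e, Finset.sum_add_distrib, Finset.sum_ite_irrel, Finset.sum_ite_eq', hs, ht, if_true,
      Finset.sum_const_zero]
    ring
  have h3 : (1:ℝ) < √2 := by
    rw [Real.lt_sqrt] <;> norm_num
  linarith

/-- Reflections connected by no odd path are not conjugate. -/
theorem oddReach_of_conj {s t : B} (w : M.Group)
    (h : w⁻¹ * M.simple s * w = M.simple t) : OddReach M s t := by
  classical
  by_contra hn
  let e : B → ℤˣ := fun u => if OddReach M s u then -1 else 1
  have he : M.IsLiftable e := by
    intro a b
    by_cases ho : Odd (M a b)
    · have : OddReach M s a ↔ OddReach M s b :=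
        ⟨fun h => h.tail ho, fun h => h.tail (by rwa [M.symmetric])⟩
      have h2 : e a = e b := by simp only [e, this]
      rw [h2, Int.units_mul_self, one_pow]
    · obtain ⟨j, hj⟩ := Nat.not_odd_iff_even.mp ho
      rw [hj, ← two_mul, pow_mul, Int.units_sq, one_pow]
  have hl : ∀ u, M.toCoxeterSystem.lift ⟨e, he⟩ (M.simple u) = e u := fun u => by
    rw [← M.toCoxeterSystem_simple]
    exact M.toCoxeterSystem.lift_apply_simple he u
  have h1 := congrArg (M.toCoxeterSystem.lift ⟨e, he⟩) h
  rw [map_mul, map_mul, hl, hl, map_inv, mul_comm, ← mul_assoc, mul_inv_cancel, one_mul] at h1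
  have hs : OddReach M s s := Relation.ReflTransGen.refl
  simp only [e, hs, hn, if_true, if_false] at h1
  exact absurd h1 (by decide)

end Rep
end ArtinTits

namespace ArtinTits
section TypeA
variable {G : Type*} [Group G]

/-- A family of elements satisfying the relations of type `A_N`. -/
structure AChain (N : ℕ) (a : ℕ → G) : Prop where
  sq : ∀ i, i < N → a i * a i = 1
  braid : ∀ i, i + 1 < N → a i * a (i+1) * a i = a (i+1) * a i * a (i+1)
  comm : ∀ i j, i + 2 ≤ j → j < N → a i * a j = a j * a i

/-- The transposition `(i, i+d+1)`. -/
def TT (a : ℕ → G) (i : ℕ) : ℕ → G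
  | 0 => a i
  | d + 1 => a (i + d + 1) * TT a i d * a (i + d + 1)

variable {N : ℕ} {a : ℕ → G}

theorem TT_conj_of_comm (h : AChain N a) {i d k : ℕ} (hk : k < N) (hc : a k * TT a i d = TT a i d * a k) :
    a k * TT a i d * a k = TT a i d := by
  rw [hc, mul_assoc, h.sq k hk, mul_one]

theorem TT_comm_gt (h : AChain N a) {i d k : ℕ} (h1 : i + d + 2 ≤ k) (hk : k < N) :
    a k * TT a i d = TT a i d * a k := by
  induction d with
  | zero => exact (h.comm i k (by omega) hk).symm
  | succ d ih =>
    have e := h.comm (i+d+1) k (by omega) hk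
    have ih := ih (by omega)
    simp only [TT]
    simp only [← mul_assoc]
    rw [← e, mul_assoc (a (i+d+1)), ih, ← mul_assoc, mul_assoc _ (a k), ← e, ← mul_assoc]

theorem TT_comm_lt (h : AChain N a) {i d k : ℕ} (h1 : k + 2 ≤ i) (hk : i + d < N) :
    a k * TT a i d = TT a i d * a k := by
  induction d with
  | zero => exact (h.comm k i (by omega) hk)
  | succ d ih =>
    have e := h.comm k (i+d+1) (by omega) hk
    have ih := ih (by omega)
    simp only [TT]
    simp only [← mul_assoc]
    rw [e, mul_assoc (a (i+d+1)), ih, ← mul_assoc, mul_assoc _ (a k), e, ← mul_assoc]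

theorem TT_comm_mid (h : AChain N a) {i d k : ℕ} (h1 : i < k) (h2 : k < i + d) (hk : i + d < N) :
    a k * TT a i d = TT a i d * a k := by
  induction d with
  | zero => omega
  | succ d ih =>
    rcases Nat.lt_or_ge k (i + d) with h3 | h3
    · have e := h.comm k (i+d+1) (by omega) hk
      have ih := ih h3 (by omega)
      simp only [TT]
      simp only [← mul_assoc]
      rw [e, mul_assoc (a (i+d+1)), ih, ← mul_assoc, mul_assoc _ (a k), e, ← mul_assoc]
    · obtain ⟨d, rfl⟩ : ∃ d', d = d' + 1 := ⟨d - 1, by omega⟩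
      obtain rfl : k = i + d + 1 := by omega
      have b := h.braid (i+d+1) (by omega)
      have c := TT_comm_gt h (i := i) (d := d) (k := i + d + 1 + 1) (by omega) (by omega)
      simp only [TT]
      rw [show i + (d+1) + 1 = i + d + 1 + 1 by omega]
      generalize TT a i d = T at *
      generalize a (i+d+1+1) = y at *
      generalize a (i+d+1) = x at *
      calc x * (y * (x * T * x) * y) = (x * y * x) * T * x * y := by group
        _ = y * x * (y * T) * x * y := by rw [b]; group
        _ = y * x * T * (y * x * y) := by rw [c]; group
        _ = y * (x * T * x) * y * x := by rw [← b]; group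

theorem TT_conj_left (h : AChain N a) {i d : ℕ} (hk : i + 1 + d < N) :
    a i * TT a (i+1) d * a i = TT a i (d+1) := by
  induction d with
  | zero => simp only [TT]; exact h.braid i hk
  | succ d ih =>
    have ih := ih (by omega)
    have e := h.comm i (i+1+d+1) (by omega) hk
    rw [TT]
    rw [TT, ← ih]
    rw [show i + (d+1) + 1 = i + 1 + d + 1 by omega]
    generalize TT a (i+1) d = T at *
    generalize a (i+1+d+1) = y at *
    calc a i * (y * T * y) * a i = (a i * y) * T * (y * a i) := by group
      _ = (y * a i) * T * (a i * y) := by rw [e]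
      _ = y * (a i * T * a i) * y := by group

/-- The transposition `(p, q)`. -/
def UU (a : ℕ → G) (p q : ℕ) : G := TT a (min p q) (max p q - min p q - 1)

theorem UU_symm (p q : ℕ) : UU a p q = UU a q p := by
  simp [UU, min_comm, max_comm]

theorem UU_lt {p q d : ℕ} (hq : q = p + d + 1) : UU a p q = TT a p d := by
  subst hq
  simp only [UU]
  congr 1 <;> omega

theorem UU_conj_lt (h : AChain N a) {k p q : ℕ} (hk : k < N) (hq : q ≤ N) (hpq : p < q) :
    a k * UU a p q * a k = UU a (Equiv.swap k (k+1) p) (Equiv.swap k (k+1) q) := by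
  obtain ⟨d, rfl⟩ : ∃ d, q = p + d + 1 := ⟨q - p - 1, by omega⟩
  rw [UU_lt rfl]
  have sw : ∀ x, Equiv.swap k (k+1) x = if x = k then k + 1 else if x = k + 1 then k else x :=
    fun x => Equiv.swap_apply_def _ _ _
  by_cases c1 : p + d + 2 ≤ k
  · rw [sw, sw, if_neg (by omega), if_neg (by omega), if_neg (by omega), if_neg (by omega),
      UU_lt rfl]
    exact TT_conj_of_comm h hk (TT_comm_gt h c1 hk)
  by_cases c2 : k = p + d + 1
  · rw [sw, sw, if_neg (by omega), if_neg (by omega), if_pos (by omega), UU_lt (d := d+1) (by omega),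
      TT, c2]
  by_cases c3 : k + 2 ≤ p
  · rw [sw, sw, if_neg (by omega), if_neg (by omega), if_neg (by omega), if_neg (by omega),
      UU_lt rfl]
    exact TT_conj_of_comm h hk (TT_comm_lt h c3 (by omega))
  by_cases c4 : k + 1 = p
  · rw [sw, sw, if_neg (by omega), if_pos (by omega), if_neg (by omega), if_neg (by omega),
      UU_lt (d := d+1) (by omega), ← TT_conj_left h (by omega), c4]
  by_cases c5 : k = p
  · subst c5
    rcases d with _ | d
    · rw [sw, sw, if_pos rfl, if_neg (by omega), if_pos (by omega), UU_symm, UU_lt (d := 0) (by omega)]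
      simp only [TT]
      rw [h.sq k hk, one_mul]
    · rw [sw, sw, if_pos rfl, if_neg (by omega), if_neg (by omega), UU_lt (d := d) (by omega),
        ← TT_conj_left h (by omega)]
      simp only [← mul_assoc]
      rw [h.sq k hk, one_mul, mul_assoc, h.sq k hk, mul_one]
  by_cases c6 : k = p + d
  · obtain ⟨d, rfl⟩ : ∃ d', d = d' + 1 := ⟨d - 1, by omega⟩
    rw [sw, sw, if_neg (by omega), if_neg (by omega), if_neg (by omega), if_pos (by omega),
      UU_lt (d := d) (by omega), TT, ← Nat.add_assoc p d 1] at *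
    rw [← c6]
    simp only [← mul_assoc]
    rw [h.sq k hk, one_mul, mul_assoc, h.sq k hk, mul_one]
  · rw [sw, sw, if_neg (by omega), if_neg (by omega), if_neg (by omega), if_neg (by omega),
      UU_lt rfl]
    exact TT_conj_of_comm h hk (TT_comm_mid h (by omega) (by omega) (by omega))

theorem UU_conj (h : AChain N a) {k p q : ℕ} (hk : k < N) (hp : p ≤ N) (hq : q ≤ N) (hpq : p ≠ q) :
    a k * UU a p q * a k = UU a (Equiv.swap k (k+1) p) (Equiv.swap k (k+1) q) := by
  rcases Nat.lt_or_gt_of_ne hpq with hlt | hlt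
  · exact UU_conj_lt h hk hq hlt
  · rw [UU_symm, UU_conj_lt h hk hp hlt, UU_symm]

theorem perm_lift (h : AChain N a) (π : Equiv.Perm (Fin (N+1))) :
    ∃ v ∈ Subgroup.closure (a '' Set.Iio N), ∀ p q : Fin (N+1), p ≠ q →
      v * UU a p q * v⁻¹ = UU a (π p) (π q) := by
  have hπ : π ∈ Submonoid.closure
      (Set.range fun i : Fin N ↦ Equiv.swap i.castSucc i.succ) := by
    rw [Equiv.Perm.mclosure_swap_castSucc_succ]; trivial
  induction hπ using Submonoid.closure_induction with
  | mem x hx =>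
    obtain ⟨i, rfl⟩ := hx
    refine ⟨a i, Subgroup.subset_closure ⟨i, i.2, rfl⟩, fun p q hpq => ?_⟩
    have hinv : (a i)⁻¹ = a i := inv_eq_of_mul_eq_one_left (h.sq i i.2)
    have sw : ∀ x : Fin (N+1), ((Equiv.swap i.castSucc i.succ x : Fin (N+1)) : ℕ)
        = Equiv.swap (i:ℕ) (i+1) x := by
      intro x
      simp only [Equiv.swap_apply_def, Fin.ext_iff, Fin.val_castSucc, Fin.val_succ]
      split_ifs <;> simp
    rw [hinv, UU_conj h i.2 (by omega) (by omega) (fun hh => hpq (Fin.ext hh))]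
    simp only [sw]
  | one => exact ⟨1, one_mem _, by simp⟩
  | mul x y _ _ hx hy =>
    obtain ⟨u, hu, hu'⟩ := hx
    obtain ⟨v, hv, hv'⟩ := hy
    refine ⟨u * v, mul_mem hu hv, fun p q hpq => ?_⟩
    rw [Equiv.Perm.mul_apply, Equiv.Perm.mul_apply, ← hu' _ _ (fun hh => hpq (y.injective hh)),
      ← hv' _ _ hpq]
    group

/-- Combinatorial extension: a partial isomorphism of paths comes from vertices. -/
theorem exists_vertex_map (Y : Set ℕ) (f : ℕ → ℕ)
    (finj : ∀ y ∈ Y, ∀ z ∈ Y, f y = f z → y = z)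
    (fadj : ∀ y ∈ Y, ∀ z ∈ Y, (y + 1 = z ∨ z + 1 = y) ↔ (f y + 1 = f z ∨ f z + 1 = f y)) :
    ∃ g : ℕ → ℕ, (∀ y ∈ Y, (g y = f y ∧ g (y+1) = f y + 1) ∨ (g y = f y + 1 ∧ g (y+1) = f y)) ∧
      (∀ p q, (p ∈ Y ∨ ∃ y ∈ Y, p = y + 1) → (q ∈ Y ∨ ∃ y ∈ Y, q = y + 1) → g p = g q → p = q) := by
  classical
  let o : ℕ → Prop := fun y => (y + 1 ∈ Y ∧ f (y+1) < f y) ∨ (∃ z ∈ Y, z + 1 = y ∧ f y < f z)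
  have hoo : ∀ y ∈ Y, y + 1 ∈ Y → (o y ↔ f (y+1) < f y) ∧ (o (y+1) ↔ f (y+1) < f y) := by
    intro y hy hy1
    have A := fadj y hy (y+1) hy1
    constructor
    · constructor
      · rintro (hh | ⟨z, hz, rfl, hlt⟩)
        · exact hh.2
        · have A2 := fadj z hz (z+1) hy
          have A3 := finj z hz (z+1+1) hy1
          omega
      · intro hh; exact Or.inl ⟨hy1, hh⟩
    · constructor
      · rintro (⟨h2, hlt⟩ | ⟨z, hz, hz1, hlt⟩)
        · have A2 := fadj (y+1) hy1 (y+1+1) h2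
          have A3 := finj y hy (y+1+1) h2
          omega
        · obtain rfl : z = y := by omega
          exact hlt
      · intro hh; exact Or.inr ⟨y, hy, rfl, hh⟩
  clear_value o
  let L : ℕ → ℕ := fun y => if o y then f y + 1 else f y
  let R : ℕ → ℕ := fun y => if o y then f y else f y + 1
  have hLR : ∀ y ∈ Y, y + 1 ∈ Y → L (y+1) = R y := by
    intro y hy hy1
    have A := fadj y hy (y+1) hy1
    obtain ⟨h1, h2⟩ := hoo y hy hy1
    simp only [L, R, h1, h2]
    split_ifs <;> omega
  let g : ℕ → ℕ := fun p => if p ∈ Y then L p else R (p - 1)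
  have gL : ∀ y ∈ Y, g y = L y := fun y hy => by simp [g, hy]
  have gR : ∀ y ∈ Y, g (y+1) = R y := fun y hy => by
    by_cases h1 : y + 1 ∈ Y
    · rw [gL _ h1, hLR y hy h1]
    · simp [g, h1]
  have LR : ∀ y, (L y = f y ∧ R y = f y + 1 ∧ ¬ o y) ∨ (L y = f y + 1 ∧ R y = f y ∧ o y) := by
    intro y
    by_cases ho : o y
    · right; simp [L, R, ho]
    · left; simp [L, R, ho]
  have LL : ∀ y ∈ Y, ∀ z ∈ Y, L y = L z → y = z := by
    intro y hy z hz e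
    have A := fadj y hy z hz
    have I := finj y hy z hz
    by_contra hne
    have hadj : y + 1 = z ∨ z + 1 = y := by
      rw [A]
      rcases LR y with ⟨a1, a2, a3⟩ | ⟨a1, a2, a3⟩ <;> rcases LR z with ⟨b1, b2, b3⟩ | ⟨b1, b2, b3⟩ <;> omega
    rcases hadj with rfl | rfl
    · rw [hLR y hy hz] at e
      rcases LR y with ⟨a1, a2, a3⟩ | ⟨a1, a2, a3⟩ <;> omega
    · rw [hLR z hz hy] at e
      rcases LR z with ⟨a1, a2, a3⟩ | ⟨a1, a2, a3⟩ <;> omega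
  have RR : ∀ y ∈ Y, ∀ z ∈ Y, R y = R z → y = z := by
    intro y hy z hz e
    have A := fadj y hy z hz
    have I := finj y hy z hz
    by_contra hne
    have hadj : y + 1 = z ∨ z + 1 = y := by
      rw [A]
      rcases LR y with ⟨a1, a2, a3⟩ | ⟨a1, a2, a3⟩ <;> rcases LR z with ⟨b1, b2, b3⟩ | ⟨b1, b2, b3⟩ <;> omega
    rcases hadj with rfl | rfl
    · rw [← hLR y hy hz] at e
      rcases LR (y+1) with ⟨a1, a2, a3⟩ | ⟨a1, a2, a3⟩ <;> omega
    · rw [← hLR z hz hy] at e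
      rcases LR (z+1) with ⟨a1, a2, a3⟩ | ⟨a1, a2, a3⟩ <;> omega
  have LRn : ∀ y ∈ Y, ∀ z ∈ Y, L y = R z → y = z + 1 := by
    intro y hy z hz e
    have A := fadj y hy z hz
    have I := finj y hy z hz
    by_contra hne
    have hyz : y ≠ z := by
      rintro rfl
      rcases LR y with ⟨a1, a2, a3⟩ | ⟨a1, a2, a3⟩ <;> omega
    have hadj : y + 1 = z ∨ z + 1 = y := by
      rw [A]
      rcases LR y with ⟨a1, a2, a3⟩ | ⟨a1, a2, a3⟩ <;> rcases LR z with ⟨b1, b2, b3⟩ | ⟨b1, b2, b3⟩ <;> omega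
    rcases hadj with rfl | rfl
    · have e2 := hLR y hy hz
      rcases LR (y+1) with ⟨a1, a2, a3⟩ | ⟨a1, a2, a3⟩ <;>
        rcases LR y with ⟨b1, b2, b3⟩ | ⟨b1, b2, b3⟩ <;> omega
    · omega
  refine ⟨g, ?_, ?_⟩
  · intro y hy
    rw [gL y hy, gR y hy]
    rcases LR y with ⟨a1, a2, a3⟩ | ⟨a1, a2, a3⟩ <;> omega
  · rintro p q (hp | ⟨p, hp, rfl⟩) (hq | ⟨q, hq, rfl⟩) e
    · rw [gL _ hp, gL _ hq] at e; exact LL _ hp _ hq e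
    · rw [gL _ hp, gR _ hq] at e; exact LRn _ hp _ hq e
    · rw [gR _ hp, gL _ hq] at e; exact (LRn _ hq _ hp e.symm).symm
    · rw [gR _ hp, gR _ hq] at e; rw [RR _ hp _ hq e]

theorem typeA_realize (h : AChain N a) (Y : Set ℕ) (f : ℕ → ℕ) (hY : ∀ y ∈ Y, y < N) (hf : ∀ y ∈ Y, f y < N)
    (finj : ∀ y ∈ Y, ∀ z ∈ Y, f y = f z → y = z)
    (fadj : ∀ y ∈ Y, ∀ z ∈ Y, (y + 1 = z ∨ z + 1 = y) ↔ (f y + 1 = f z ∨ f z + 1 = f y)) :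
    ∃ v ∈ Subgroup.closure (a '' Set.Iio N), ∀ y ∈ Y, v * a y * v⁻¹ = a (f y) := by
  obtain ⟨g, hg, ginj⟩ := exists_vertex_map Y f finj fadj
  let P : Set (Fin (N+1)) := {p | (p : ℕ) ∈ Y ∨ ∃ y ∈ Y, (p : ℕ) = y + 1}
  have gle : ∀ p : Fin (N+1), p ∈ P → g p < N + 1 := by
    rintro p (hp | ⟨y, hy, e⟩)
    · have := hg _ hp; have := hf _ hp; omega
    · have := hg _ hy; have := hf _ hy; rw [e]; omega
  let g' : Fin (N+1) → Fin (N+1) := fun p => Fin.ofNat (N+1) (g p)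
  have hg' : ∀ p ∈ P, ((g' p : Fin (N+1)) : ℕ) = g p := fun p hp => by
    simp [g', Nat.mod_eq_of_lt (gle p hp)]
  obtain ⟨π, hπ⟩ := Set.MapsTo.exists_equiv_extend_of_card_eq (α := Fin (N+1))
    (t := (Finset.univ : Finset (Fin (N+1)))) (by simp) (s := P) (f := g') (by intro x _; simp) (by
      intro p hp q hq e
      have := congrArg Fin.val e
      rw [hg' p hp, hg' q hq] at this
      exact Fin.ext (ginj p q hp hq this))
  let π' : Equiv.Perm (Fin (N+1)) := π.trans (Equiv.subtypeUnivEquiv (by simp))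
  obtain ⟨v, hv, hv'⟩ := perm_lift h π'
  refine ⟨v, hv, fun y hy => ?_⟩
  have hyN := hY y hy
  have key := hv' ⟨y, by omega⟩ ⟨y+1, by omega⟩ (by simp)
  have m1 : (⟨y, by omega⟩ : Fin (N+1)) ∈ P := Or.inl hy
  have m2 : (⟨y+1, by omega⟩ : Fin (N+1)) ∈ P := Or.inr ⟨y, hy, rfl⟩
  have e1 : ((π' ⟨y, by omega⟩ : Fin (N+1)) : ℕ) = g y := by
    rw [← hg' _ m1, ← hπ _ m1]; rfl
  have e2 : ((π' ⟨y+1, by omega⟩ : Fin (N+1)) : ℕ) = g (y+1) := by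
    rw [← hg' _ m2, ← hπ _ m2]; rfl
  rw [e1, e2, UU_lt (d := 0) rfl] at key
  simp only [TT] at key
  rw [key]
  rcases hg y hy with ⟨c1, c2⟩ | ⟨c1, c2⟩
  · rw [c1, c2, UU_lt (d := 0) rfl]; rfl
  · rw [c1, c2, UU_symm, UU_lt (d := 0) rfl]; rfl

end TypeA
end ArtinTits

namespace ArtinTits

/-- Lemma 3 of the paper, first case: if `W_S` is a finite irreducible Coxeter group and `W_X`
is of type `Bₙ`, then `(W_X, W_S)` satisfies Property `⋆_W`. -/
theorem starW_of_type_B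
    {B : Type*} [Finite B] (M : CoxeterMatrix B) [Finite M.Group]
    (hconn : ConnectedIn M Set.univ)
    (X : Set B) (hX : X.Nonempty) (hXproper : X ≠ Set.univ)
    (n : ℕ) (hn : 2 ≤ n) (htype : IsOfType M X (Bmat n)) :
    StarW M X := by
  classical
  have := Fintype.ofFinite B
  obtain ⟨e, he⟩ := htype
  let b : ℕ → B := fun i => if h : i < n then (e.symm ⟨i, h⟩ : X) else hX.some
  have hbX : ∀ i, i < n → b i ∈ X := fun i hi => by simp [b, hi]
  have hb : ∀ x ∈ X, ∃ i, i < n ∧ b i = x := fun x hx => by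
    refine ⟨e ⟨x, hx⟩, (e ⟨x, hx⟩).2, ?_⟩
    simp [b]
  have hM : ∀ i j (hi : i < n) (hj : j < n), M (b i) (b j) = Bmat n ⟨i, hi⟩ ⟨j, hj⟩ := by
    intro i j hi hj
    simp only [b, hi, hj, dif_pos]
    rw [he]; simp
  have binj : ∀ i j, i < n → j < n → b i = b j → i = j := by
    intro i j hi hj h
    simp only [b, hi, hj, dif_pos] at h
    have := e.symm.injective (Subtype.ext h)
    simpa using this
  have M2 : ∀ i j, i + 2 ≤ j → j < n → M (b i) (b j) = 2 := by
    intro i j hij hj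
    rw [hM i j (by omega) hj]
    simp only [Bmat, Matrix.of_apply, Fin.mk.injEq]
    rw [if_neg (by omega), if_neg (by omega), if_neg (by omega)]
  have M3 : ∀ i, 1 ≤ i → i + 1 < n → M (b i) (b (i+1)) = 3 := by
    intro i hi hj
    rw [hM i (i+1) (by omega) hj]
    simp only [Bmat, Matrix.of_apply, Fin.mk.injEq]
    rw [if_neg (by omega), if_neg (by omega)]
    simp
  have M4 : M (b 0) (b 1) = 4 := by
    rw [hM 0 1 (by omega) (by omega)]
    simp [Bmat]
  clear_value b
  let S : ℕ → M.Group := fun i => M.simple (b i)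
  have Ssq : ∀ i, S i * S i = 1 := fun i => M.toCoxeterSystem.simple_mul_simple_self (b i)
  have Spow : ∀ i j, (S i * S j) ^ M (b i) (b j) = 1 :=
    fun i j => M.toCoxeterSystem.simple_mul_simple_pow (b i) (b j)
  have Sinv : ∀ i, (S i)⁻¹ = S i := fun i => inv_eq_of_mul_eq_one_left (Ssq i)
  have Scomm : ∀ i j, i + 2 ≤ j → j < n → S i * S j = S j * S i := by
    intro i j hij hj
    have h := Spow i j
    rw [M2 i j hij hj, pow_two] at h
    have := eq_inv_of_mul_eq_one_left h
    rw [this, mul_inv_rev, Sinv, Sinv]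
  have Sbraid : ∀ i, 1 ≤ i → i + 1 < n → S i * S (i+1) * S i = S (i+1) * S i * S (i+1) := by
    intro i hi hj
    have h := Spow i (i+1)
    rw [M3 i hi hj] at h
    have h' : (S i * S (i+1) * S i) * (S (i+1) * S i * S (i+1)) = 1 := by
      rw [← h]; simp only [pow_succ, pow_zero, one_mul, mul_assoc]
    have := eq_inv_of_mul_eq_one_left h'
    rw [this, mul_inv_rev, mul_inv_rev, Sinv, Sinv, mul_assoc]
  have Sadj : ∀ i j, i < n → j < n → i ≠ j → S i * S j = S j * S i → ¬ (i + 1 = j ∨ j + 1 = i) := by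
    have aux : ∀ i, i + 1 < n → S i * S (i+1) ≠ S (i+1) * S i := by
      intro i hi h
      have hne : b i ≠ b (i+1) := fun h => by
        have := binj i (i+1) (by omega) hi h
        omega
      have := M_two_of_commute M hne h
      rcases Nat.eq_zero_or_pos i with rfl | h0
      · rw [M4] at this; omega
      · rw [M3 i h0 hi] at this; omega
    rintro i j hi hj hne h (rfl | rfl)
    · exact aux i hj h
    · exact aux j hi h.symm
  have Sinj : ∀ i j, i < n → j < n → S i = S j → i = j :=
    fun i j hi hj h => binj i j hi hj (simple_inj_s8 M h)
  have noconj : ∀ j, 1 ≤ j → j < n → ∀ w : M.Group, w⁻¹ * S 0 * w ≠ S j := by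
    intro j h1 hj w h
    have h2 : OddReach M (b 0) (b j) := oddReach_of_conj M w h
    refine not_oddReach M hconn M4 ?_
    clear h
    induction j, h1 using Nat.le_induction with
    | base => exact h2
    | succ j h1 ih =>
      refine ih (by omega) (h2.tail ?_)
      rw [M.symmetric, M3 j h1 hj]
      decide
  intro Y1 Y2 hY1 hY2 w hw
  let Y : Set ℕ := {i | i < n ∧ b i ∈ Y1}
  have hex : ∀ i, ∃ j, i ∈ Y → j < n ∧ w⁻¹ * S i * w = S j := by
    intro i
    by_cases hi : i ∈ Y
    · have : w⁻¹ * S i * w ∈ M.simple '' Y2 := by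
        rw [← hw]; exact ⟨S i, ⟨b i, hi.2, rfl⟩, rfl⟩
      obtain ⟨y, hy, h⟩ := this
      obtain ⟨j, hj, rfl⟩ := hb y (hY2 hy)
      exact ⟨j, fun _ => ⟨hj, h.symm⟩⟩
    · exact ⟨0, fun h => absurd h hi⟩
  choose f hf using hex
  have hYn : ∀ y ∈ Y, y < n := fun y hy => hy.1
  have finj : ∀ y ∈ Y, ∀ z ∈ Y, f y = f z → y = z := by
    intro y hy z hz h
    have h1 := (hf y hy).2
    rw [h, ← (hf z hz).2] at h1
    exact Sinj y z (hYn y hy) (hYn z hz) (by simpa using h1)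
  have fcomm : ∀ y ∈ Y, ∀ z ∈ Y, (S y * S z = S z * S y ↔ S (f y) * S (f z) = S (f z) * S (f y)) := by
    intro y hy z hz
    rw [← (hf y hy).2, ← (hf z hz).2]
    have e1 : ∀ p q : M.Group, w⁻¹ * p * w * (w⁻¹ * q * w) = w⁻¹ * (p * q) * w := by
      intro p q; group
    rw [e1, e1]
    simp
  have adj_iff : ∀ i j, i < n → j < n → ((i + 1 = j ∨ j + 1 = i) ↔ (i ≠ j ∧ ¬ S i * S j = S j * S i)) := by
    intro i j hi hj
    constructor
    · intro h
      have hne : i ≠ j := by omega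
      exact ⟨hne, fun hc => Sadj i j hi hj hne hc h⟩
    · rintro ⟨hne, hc⟩
      by_contra hno
      rcases Nat.lt_or_gt_of_ne hne with hlt | hlt
      · exact hc (Scomm i j (by omega) hj)
      · exact hc (Scomm j i (by omega) hi).symm
  have fadj : ∀ y ∈ Y, ∀ z ∈ Y, (y + 1 = z ∨ z + 1 = y) ↔ (f y + 1 = f z ∨ f z + 1 = f y) := by
    intro y hy z hz
    rw [adj_iff y z (hYn y hy) (hYn z hz), adj_iff _ _ (hf y hy).1 (hf z hz).1, fcomm y hy z hz]
    have : y ≠ z ↔ f y ≠ f z := ⟨fun h h' => h (finj y hy z hz h'), fun h h' => h (by rw [h'])⟩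
    rw [this]
  have f0 : ∀ y ∈ Y, y = 0 ↔ f y = 0 := by
    intro y hy
    obtain ⟨h1, h2⟩ := hf y hy
    constructor
    · rintro rfl
      by_contra h0
      exact noconj (f 0) (by omega) h1 w h2
    · intro h0
      by_contra hy0
      refine noconj y (by omega) (hYn y hy) w⁻¹ ?_
      rw [h0] at h2
      rw [← h2]; group
  have hkex : ∃ k, k ∉ Y := ⟨n, fun h => absurd (hYn n h) (lt_irrefl n)⟩
  obtain ⟨k, hkY, hklt⟩ : ∃ k, k ∉ Y ∧ ∀ i, i < k → i ∈ Y :=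
    ⟨Nat.find hkex, Nat.find_spec hkex, fun i hi => by
      have := Nat.find_min hkex hi
      exact not_not.mp this⟩
  have ffix : ∀ i, i < k → f i = i := by
    intro i
    induction i using Nat.strong_induction_on with
    | _ i ih =>
      intro hi
      rcases Nat.eq_zero_or_pos i with rfl | h0
      · exact (f0 0 (hklt 0 hi)).mp rfl
      obtain ⟨j, rfl⟩ : ∃ j, i = j + 1 := ⟨i - 1, by omega⟩
      have h1 := ih j (by omega) (by omega)
      have h2 := (fadj j (hklt j (by omega)) (j+1) (hklt _ hi)).mp (Or.inl rfl)
      rcases h2 with h2 | h2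
      · omega
      · have h3 := ih (j-1) (by omega) (by omega)
        have h4 := finj (j-1) (hklt _ (by omega)) (j+1) (hklt _ hi) (by omega)
        omega
  have fgt : ∀ y ∈ Y, k < y → k < f y := by
    intro y hy hky
    by_contra hle
    rcases Nat.lt_or_ge (f y) k with h1 | h1
    · have := finj (f y) (hklt _ h1) y hy (ffix _ h1)
      omega
    · have h2 : f y = k := by omega
      rcases Nat.eq_zero_or_pos k with h0 | h0
      · have := f0 y hy; omega
      · have h3 := ffix (k-1) (by omega)
        have h4 := (fadj (k-1) (hklt _ (by omega)) y hy).mpr (by omega)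
        omega
  let a : ℕ → M.Group := fun i => S (k + 1 + i)
  have hA : AChain (n - 1 - k) a :=
    ⟨fun i _ => Ssq _, fun i hi => Sbraid (k+1+i) (by omega) (by omega),
      fun i j hij hj => Scomm _ _ (by omega) (by omega)⟩
  obtain ⟨v, hv, hva⟩ := typeA_realize hA {i | k + 1 + i ∈ Y} (fun i => f (k+1+i) - (k+1))
    (fun y hy => by have := hYn _ hy; omega)
    (fun y hy => by have := (hf _ hy).1; have := fgt _ hy (by omega); omega)
    (fun y hy z hz h => by
      have h1 := fgt _ hy (by omega)
      have h2 := fgt _ hz (by omega)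
      have := finj _ hy _ hz (by omega)
      omega)
    (fun y hy z hz => by
      have h1 := fgt _ hy (by omega)
      have h2 := fgt _ hz (by omega)
      have := fadj _ hy _ hz
      omega)
  refine ⟨v⁻¹, inv_mem ?_, ?_⟩
  · refine (Subgroup.closure_mono ?_) hv
    rintro _ ⟨i, hi, rfl⟩
    exact ⟨b (k+1+i), hbX _ (by have : i < n - 1 - k := hi; omega), rfl⟩
  · intro y hy
    obtain ⟨i, hi, rfl⟩ := hb y (hY1 hy)
    have hiY : i ∈ Y := ⟨hi, hy⟩
    rw [inv_inv]
    change v * S i * v⁻¹ = w⁻¹ * S i * w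
    rw [(hf i hiY).2]
    rcases Nat.lt_or_ge i k with h1 | h1
    · rw [ffix i h1]
      have hc : v ∈ Subgroup.centralizer {S i} := by
        refine (Subgroup.closure_le _).mpr ?_ hv
        rintro _ ⟨j, hj, rfl⟩
        have : j < n - 1 - k := hj
        exact Subgroup.mem_centralizer_singleton_iff.mpr
          (Scomm i (k+1+j) (by omega) (by omega)).symm
      rw [Subgroup.mem_centralizer_singleton_iff.mp hc]
      group
    · have h2 : i ≠ k := fun h => hkY (h ▸ hiY)
      obtain ⟨j, rfl⟩ : ∃ j, i = k + 1 + j := ⟨i - (k+1), by omega⟩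
      have h3 := hva j hiY
      have h4 := fgt _ hiY (by omega)
      change v * S (k+1+j) * v⁻¹ = S (k + 1 + (f (k+1+j) - (k+1))) at h3
      rw [h3]
      congr 1
      omega

end ArtinTits
end
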